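/- arXiv:1903.02668 — 2 statements merged into one kernel-verified Lean document; each statement's English description precedes it below -/
import Mathlib

section
/- Let R be a commutative Noetherian catenary ring of finite Krull dimension. Form the 'local' adelic cochain complex: for s ≥ 0, C^s is the product over all flags p0 > p1 > ⋯ > ps in the Balmer order (strictly increasing chains of prime ideals p0 ⊊ p1 ⊊ ⋯ ⊊ ps) of the nested modules L_{p0}( ∏ L_{p1}( ⋯ ∏ L_{ps}( Λ'_{ps} R ) ⋯ )), where L_p is localization at p, and Λ'_p R equals the p-adic completion lim_n R/p^n when p is a maximal ideal (a closed point, of dimension 0) and equals R otherwise; the differential is the alternating sum δ = Σ (−1)^i δ_i as in the adelic complex, with δ_i for i ≤ s inserting the localization unit at the i-th spot and δ_{s+1} induced by the coefficient structure maps Λ'_{p_s}R → Λ'_{p_{s+1}}R. Then H^0 of this complex is isomorphic to R and H^s = 0 for all s > 0. -/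
section AdelicMachinery

variable (R : Type) [CommRing R]

/-- The `R`-linear map on localized modules induced by `f : M →ₗ[R] N`. -/
noncomputable def locMap (S : Submonoid R) {M N : Type} [AddCommGroup M] [Module R M]
    [AddCommGroup N] [Module R N] (f : M →ₗ[R] N) :
    LocalizedModule S M →ₗ[R] LocalizedModule S N :=
  IsLocalizedModule.map S (LocalizedModule.mkLinearMap S M)
    (LocalizedModule.mkLinearMap S N) f

open Classical in
/-- The `local` coefficient system `Λ'`: the `p`-adic completion of `R` at closed
points (maximal ideals), and `R` itself at all other primes. -/
noncomputable def Lam' (p : PrimeSpectrum R) : ModuleCat R :=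
  if p.asIdeal.IsMaximal then ModuleCat.of R (AdicCompletion p.asIdeal R)
  else ModuleCat.of R R

/-- The structure maps `Λ'_p R → Λ'_q R` of the coefficient system, for `p ⊆ q`. -/
noncomputable def lamMap {p q : PrimeSpectrum R} (h : p < q) :
    Lam' R p →ₗ[R] Lam' R q := by
  unfold Lam'
  by_cases hp : p.asIdeal.IsMaximal
  · exact absurd (PrimeSpectrum.ext (hp.eq_of_le q.isPrime.ne_top (le_of_lt h)))
      (ne_of_lt h)
  · rw [if_neg hp]
    by_cases hq : q.asIdeal.IsMaximal
    · rw [if_pos hq]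
      exact AdicCompletion.of q.asIdeal R
    · rw [if_neg hq]
      exact LinearMap.id

/-- The canonical map `R → Λ'_p R`. -/
noncomputable def toLam' (p : PrimeSpectrum R) : R →ₗ[R] Lam' R p := by
  unfold Lam'
  by_cases hp : p.asIdeal.IsMaximal
  · rw [if_pos hp]
    exact AdicCompletion.of p.asIdeal R
  · rw [if_neg hp]
    exact LinearMap.id

/-- The nested adelic modules over flags in the Balmer order (reverse inclusion):
`G s p = L_p (∏_{p₁ ⊋ p} L_{p₁} ( ⋯ ∏_{p_s ⊋ p_{s-1}} L_{p_s}(Λ'_{p_s} R) ⋯ ))`. -/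
noncomputable def G : ℕ → PrimeSpectrum R → ModuleCat R
  | 0, p => ModuleCat.of R (LocalizedModule p.asIdeal.primeCompl (Lam' R p))
  | k + 1, p => ModuleCat.of R
      (LocalizedModule p.asIdeal.primeCompl
        (∀ q : {q : PrimeSpectrum R // p < q}, G k q.1))

/-- Insertion of a new flag entry immediately below `p`, via the localization units. -/
noncomputable def phi (k : ℕ) (p : PrimeSpectrum R) :
    (∀ q : {q : PrimeSpectrum R // p < q}, G R k q.1) →ₗ[R]
      (∀ q : {q : PrimeSpectrum R // p < q}, G R (k + 1) q.1) :=
  LinearMap.pi fun q' =>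
    (LocalizedModule.mkLinearMap q'.1.asIdeal.primeCompl
        (∀ r : {r : PrimeSpectrum R // q'.1 < r}, G R k r.1)) ∘ₗ
      (LinearMap.pi fun r : {r : PrimeSpectrum R // q'.1 < r} =>
        LinearMap.proj (⟨r.1, lt_trans q'.2 r.2⟩ : {q : PrimeSpectrum R // p < q}))

/-- Insertion below the innermost flag entry: uses the coefficient structure maps
`Λ'_{p}R → Λ'_{q}R` followed by the localization units. -/
noncomputable def psi (p : PrimeSpectrum R) :
    Lam' R p →ₗ[R] (∀ q : {q : PrimeSpectrum R // p < q}, G R 0 q.1) :=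
  LinearMap.pi fun q =>
    (LocalizedModule.mkLinearMap q.1.asIdeal.primeCompl (Lam' R q.1)) ∘ₗ lamMap R q.2

/-- `ins i s p : G s p → G (s+1) p` inserts a new flag entry at depth `i+1` below `p`. -/
noncomputable def ins : ℕ → (s : ℕ) → (p : PrimeSpectrum R) → (G R s p →ₗ[R] G R (s + 1) p)
  | 0, 0, p => locMap R p.asIdeal.primeCompl (psi R p)
  | 0, k + 1, p => locMap R p.asIdeal.primeCompl (phi R k p)
  | _ + 1, 0, p => locMap R p.asIdeal.primeCompl (psi R p)
  | i + 1, k + 1, p => locMap R p.asIdeal.primeCompl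
      (LinearMap.pi fun q : {q : PrimeSpectrum R // p < q} =>
        (ins i k q.1) ∘ₗ LinearMap.proj q)

/-- The `i`-th face map `δᵢ : C^s → C^{s+1}` of the adelic cochain complex. -/
noncomputable def delta (s i : ℕ) :
    (∀ p : PrimeSpectrum R, G R s p) →ₗ[R] (∀ p : PrimeSpectrum R, G R (s + 1) p) :=
  if i = 0 then
    LinearMap.pi fun p =>
      (LocalizedModule.mkLinearMap p.asIdeal.primeCompl
          (∀ q : {q : PrimeSpectrum R // p < q}, G R s q.1)) ∘ₗ
        (LinearMap.pi fun q : {q : PrimeSpectrum R // p < q} => LinearMap.proj q.1)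
  else
    LinearMap.pi fun p => (ins R (i - 1) s p) ∘ₗ LinearMap.proj p

/-- The total differential `δ = Σᵢ (-1)ⁱ δᵢ` of the adelic cochain complex. -/
noncomputable def adelicD (s : ℕ) :
    (∀ p : PrimeSpectrum R, G R s p) →ₗ[R] (∀ p : PrimeSpectrum R, G R (s + 1) p) :=
  ∑ i ∈ Finset.range (s + 2), ((-1 : ℤ) ^ i) • delta R s i

/-- The canonical augmentation `R → C⁰ = ∏_p L_p(Λ'_p R)`. -/
noncomputable def adelicAug : R →ₗ[R] (∀ p : PrimeSpectrum R, G R 0 p) :=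
  LinearMap.pi fun p =>
    (LocalizedModule.mkLinearMap p.asIdeal.primeCompl (Lam' R p)) ∘ₗ toLam' R p

/-- A partial order is catenary if any two saturated chains with the same endpoints
have the same length. -/
def IsCatenaryOrder (α : Type*) [PartialOrder α] : Prop :=
  ∀ c d : LTSeries α, c.head = d.head → c.last = d.last →
    (∀ i : Fin c.length, c.toFun i.castSucc ⋖ c.toFun i.succ) →
    (∀ i : Fin d.length, d.toFun i.castSucc ⋖ d.toFun i.succ) →
    c.length = d.length

end AdelicMachinery

section LocalCoefficients

variable (R : Type) [CommRing R]

theorem exists_linearEquiv_cast {N B : ModuleCat R} (h : N = B)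
    (hT : (R →ₗ[R] N) = (R →ₗ[R] B)) (f : R →ₗ[R] B) :
    ∃ e : N ≃ₗ[R] B, ∀ x, e (hT.mpr f x) = f x := by
  subst h
  exact ⟨LinearEquiv.refl R _, fun _ => rfl⟩

theorem cast_apply_cast {N N' B : ModuleCat R} (h : N = B)
    (hT : (R →ₗ[R] N) = (R →ₗ[R] B)) (hT' : (N →ₗ[R] N') = (B →ₗ[R] N'))
    (f : R →ₗ[R] B) (g : B →ₗ[R] N') (x : R) :
    (hT'.mpr g) (hT.mpr f x) = g (f x) := by
  subst h
  rfl

theorem exists_lam'_equiv_adicCompletion (p : PrimeSpectrum R) (hp : p.asIdeal.IsMaximal) :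
    ∃ e : Lam' R p ≃ₗ[R] AdicCompletion p.asIdeal R,
      ∀ x, e (toLam' R p x) = AdicCompletion.of p.asIdeal R x := by
  unfold toLam'
  rw [dif_pos hp]
  exact exists_linearEquiv_cast R (B := ModuleCat.of R (AdicCompletion p.asIdeal R)) (if_pos hp) _ _

theorem exists_lam'_equiv_self (p : PrimeSpectrum R) (hp : ¬ p.asIdeal.IsMaximal) :
    ∃ e : Lam' R p ≃ₗ[R] R, ∀ x, e (toLam' R p x) = x := by
  unfold toLam'
  rw [dif_neg hp]
  exact exists_linearEquiv_cast R (B := ModuleCat.of R R) (if_neg hp) _ _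

theorem not_isMaximal_of_lt {p q : PrimeSpectrum R} (h : p < q) : ¬ p.asIdeal.IsMaximal :=
  fun hp => absurd (PrimeSpectrum.ext (hp.eq_of_le q.isPrime.ne_top h.le)) h.ne

theorem toLam'_surjective {p : PrimeSpectrum R} (hp : ¬ p.asIdeal.IsMaximal) :
    Function.Surjective (toLam' R p) := by
  obtain ⟨e, he⟩ := exists_lam'_equiv_self R p hp
  exact fun y => ⟨e y, e.injective (he _)⟩

theorem lamMap_toLam' {p q : PrimeSpectrum R} (h : p < q) (x : R) :
    lamMap R h (toLam' R p x) = toLam' R q x := by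
  have hp := not_isMaximal_of_lt R h
  unfold lamMap toLam'
  rw [dif_neg hp, dif_neg hp]
  exact cast_apply_cast R (B := ModuleCat.of R R) (if_neg hp) _ _ _ _ _

instance flat_lam' [IsNoetherianRing R] (p : PrimeSpectrum R) : Module.Flat R (Lam' R p) := by
  by_cases hp : p.asIdeal.IsMaximal
  · obtain ⟨e, -⟩ := exists_lam'_equiv_adicCompletion R p hp
    exact Module.Flat.of_linearEquiv e
  · obtain ⟨e, -⟩ := exists_lam'_equiv_self R p hp
    exact Module.Flat.of_linearEquiv e

theorem isAdicComplete_quotient_self (I : Ideal R) : IsAdicComplete I (R ⧸ I) := by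
  have key : I ^ 1 • (⊤ : Submodule R (R ⧸ I)) = ⊥ := by
    rw [pow_one, eq_bot_iff, Submodule.smul_le]
    intro r hr x _
    obtain ⟨y, rfl⟩ := Ideal.Quotient.mk_surjective x
    rw [← Ideal.Quotient.mk_eq_mk, ← Submodule.Quotient.mk_smul]
    exact (Submodule.mem_bot R).2 <| (Submodule.Quotient.mk_eq_zero _).2 (I.mul_mem_right _ hr)
  refine { haus' := fun x hx => ?_, prec' := fun f hf => ⟨f 1, fun n => ?_⟩ }
  · have := hx 1
    rwa [key, SModEq.bot] at this
  · rcases Nat.eq_zero_or_pos n with rfl | hn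
    · rw [pow_zero, Ideal.one_eq_top, Submodule.top_smul]
      exact SModEq.top
    · have := hf hn
      rw [key, SModEq.bot] at this
      rw [this]

theorem bijective_rTensor_toLam' [IsNoetherianRing R] (p : PrimeSpectrum R) :
    Function.Bijective ((toLam' R p).rTensor (R ⧸ p.asIdeal)) := by
  by_cases hp : p.asIdeal.IsMaximal
  · obtain ⟨e, he⟩ := exists_lam'_equiv_adicCompletion R p hp
    have h1 := AdicCompletion.ofTensorProduct_bijective_of_finite_of_isNoetherian
      p.asIdeal (R ⧸ p.asIdeal)
    have h2 : Function.Bijective (AdicCompletion.of p.asIdeal (R ⧸ p.asIdeal)) :=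
      AdicCompletion.of_bijective_iff.2 (isAdicComplete_quotient_self R _)
    have h3 := (e.rTensor (R ⧸ p.asIdeal)).bijective
    have h4 := (TensorProduct.lid R (R ⧸ p.asIdeal)).bijective
    have h5 := h2.comp h4
    have h6 := h1.comp h3
    have : (AdicCompletion.of p.asIdeal (R ⧸ p.asIdeal)) ∘ TensorProduct.lid R (R ⧸ p.asIdeal) =
        ((AdicCompletion.ofTensorProduct p.asIdeal (R ⧸ p.asIdeal)) ∘
          e.rTensor (R ⧸ p.asIdeal)) ∘ ((toLam' R p).rTensor (R ⧸ p.asIdeal)) := by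
      funext x
      induction x with
      | zero => simp
      | add x y hx hy =>
        simp only [Function.comp_apply, map_add] at hx hy ⊢
        rw [hx, hy]
      | tmul x y =>
        simp only [Function.comp_apply, TensorProduct.lid_tmul, map_smul, LinearMap.rTensor_tmul,
          LinearEquiv.rTensor_tmul, he, AdicCompletion.ofTensorProduct_tmul]
        exact (algebraMap_smul (AdicCompletion p.asIdeal R) x _).symm
    rw [this] at h5
    exact (Function.Bijective.of_comp_iff' h6 _).1 h5
  · obtain ⟨e, he⟩ := exists_lam'_equiv_self R p hp
    have : Function.Bijective (toLam' R p) := by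
      refine ⟨fun x y h => ?_, toLam'_surjective R hp⟩
      rw [← he x, ← he y, h]
    exact ((LinearEquiv.ofBijective _ this).rTensor (R ⧸ p.asIdeal)).bijective

section Localization

variable {R} (S : Submonoid R) {M N P Q : Type} [AddCommGroup M] [Module R M]
  [AddCommGroup N] [Module R N] [AddCommGroup P] [Module R P] [AddCommGroup Q] [Module R Q]

theorem locMap_mkLinearMap (f : M →ₗ[R] N) (x : M) :
    locMap R S f (LocalizedModule.mkLinearMap S M x) = LocalizedModule.mkLinearMap S N (f x) :=
  IsLocalizedModule.map_apply S _ _ f x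

theorem locMap_mk (f : M →ₗ[R] N) (x : M) (s : S) :
    locMap R S f (LocalizedModule.mk x s) = LocalizedModule.mk (f x) s :=
  IsLocalizedModule.map_LocalizedModules S f x s

theorem locMap_locMap_congr {f : M →ₗ[R] N} {g : N →ₗ[R] Q} {f' : M →ₗ[R] P} {g' : P →ₗ[R] Q}
    (h : ∀ x, g (f x) = g' (f' x)) (y : LocalizedModule S M) :
    locMap R S g (locMap R S f y) = locMap R S g' (locMap R S f' y) := by
  induction y using LocalizedModule.induction_on with
  | h m s => simp only [locMap_mk, h]

theorem locMap_locMap_eq_zero {f : M →ₗ[R] N} {g : N →ₗ[R] Q} (h : ∀ x, g (f x) = 0)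
    (y : LocalizedModule S M) : locMap R S g (locMap R S f y) = 0 := by
  induction y using LocalizedModule.induction_on with
  | h m s => simp only [locMap_mk, h, LocalizedModule.zero_mk]

theorem locMap_apply_of_smul {f : M →ₗ[R] M} {a : R} (h : ∀ x, f x = a • x)
    (y : LocalizedModule S M) : locMap R S f y = a • y := by
  induction y using LocalizedModule.induction_on with
  | h m s => rw [locMap_mk, h, LocalizedModule.smul'_mk]

theorem locMap_exact {f : M →ₗ[R] N} {g : N →ₗ[R] P} (h : Function.Exact f g) :
    Function.Exact (locMap R S f) (locMap R S g) :=
  LocalizedModule.map_exact S f g h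

theorem locMap_injective {f : M →ₗ[R] N} (h : Function.Injective f) :
    Function.Injective (locMap R S f) :=
  IsLocalizedModule.map_injective S _ _ f h

theorem locMap_surjective {f : M →ₗ[R] N} (h : Function.Surjective f) :
    Function.Surjective (locMap R S f) :=
  IsLocalizedModule.map_surjective S _ _ f h

end Localization

/-- The primes which may be the first entry of a flag below `p`, where `none` stands for
an additional bottom element. -/
def FlagAbove : Option (PrimeSpectrum R) → PrimeSpectrum R → Prop
  | none, _ => True
  | some p, q => p < q

variable {R} in
theorem FlagAbove.trans {p : Option (PrimeSpectrum R)} {q r : PrimeSpectrum R}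
    (h : FlagAbove R p q) (h' : q < r) : FlagAbove R p r := by
  cases p with
  | none => trivial
  | some p => exact lt_trans h h'

/-- The coefficient system `Λ'`, extended by `R` at the additional bottom element. -/
noncomputable def coeff : Option (PrimeSpectrum R) → ModuleCat R
  | none => ModuleCat.of R R
  | some p => Lam' R p

/-- The structure maps of the extended coefficient system. -/
noncomputable def coeffMap :
    (p : Option (PrimeSpectrum R)) → (q : PrimeSpectrum R) → FlagAbove R p q →
      (coeff R p →ₗ[R] coeff R (some q))
  | none, q, _ => toLam' R q
  | some _, _, h => lamMap R h

theorem coeffMap_coeffMap {p : Option (PrimeSpectrum R)} {q r : PrimeSpectrum R}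
    (h : FlagAbove R p q) (h' : q < r) (x : coeff R p) :
    coeffMap R (some q) r h' (coeffMap R p q h x) = coeffMap R p r (h.trans h') x := by
  cases p with
  | none => exact lamMap_toLam' R h' x
  | some p =>
    obtain ⟨x, rfl⟩ := toLam'_surjective R (not_isMaximal_of_lt R h) x
    exact (congrArg (lamMap R h') (lamMap_toLam' R h x)).trans
      ((lamMap_toLam' R h' x).trans (lamMap_toLam' R (lt_trans h h') x).symm)

instance flat_coeff [IsNoetherianRing R] (p : Option (PrimeSpectrum R)) :
    Module.Flat R (coeff R p) := by
  cases p with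
  | none => exact inferInstanceAs (Module.Flat R R)
  | some p => exact flat_lam' R p

section Tower

open scoped TensorProduct

variable (M : Type) [AddCommGroup M] [Module R M]

/-- The complex of products of nested adelic modules over the flags below `p`, with
coefficients in `Λ' ⊗ M`, augmented by `Λ'_p ⊗ M` in degree zero. -/
noncomputable def tower : ℕ → Option (PrimeSpectrum R) → ModuleCat R
  | 0, p => ModuleCat.of R (coeff R p ⊗[R] M)
  | s + 1, p => ModuleCat.of R (∀ q : {q : PrimeSpectrum R // FlagAbove R p q},
      LocalizedModule q.1.asIdeal.primeCompl (tower s (some q.1)))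

/-- The restriction to flags below a smaller entry. -/
noncomputable def towerRes : (s : ℕ) → (p : Option (PrimeSpectrum R)) → (q : PrimeSpectrum R) →
    FlagAbove R p q → (tower R M s p →ₗ[R] tower R M s (some q))
  | 0, p, q, h => (coeffMap R p q h).rTensor M
  | s + 1, _, _, h => LinearMap.pi fun r =>
      LinearMap.proj (φ := fun r : {r : PrimeSpectrum R // FlagAbove R _ r} =>
        LocalizedModule r.1.asIdeal.primeCompl (tower R M s (some r.1)))
        ⟨r.1, h.trans r.2⟩

/-- The differential of the complex `tower`. -/
noncomputable def towerD : (s : ℕ) → (p : Option (PrimeSpectrum R)) →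
    (tower R M s p →ₗ[R] tower R M (s + 1) p)
  | 0, p => LinearMap.pi fun q =>
      LocalizedModule.mkLinearMap q.1.asIdeal.primeCompl (tower R M 0 (some q.1)) ∘ₗ
        towerRes R M 0 p q.1 q.2
  | s + 1, p => LinearMap.pi fun q =>
      LocalizedModule.mkLinearMap q.1.asIdeal.primeCompl (tower R M (s + 1) (some q.1)) ∘ₗ
        towerRes R M (s + 1) p q.1 q.2 -
      locMap R q.1.asIdeal.primeCompl (towerD s (some q.1)) ∘ₗ LinearMap.proj q

theorem towerRes_towerRes (s : ℕ) {p : Option (PrimeSpectrum R)} {q r : PrimeSpectrum R}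
    (h : FlagAbove R p q) (h' : q < r) (x : tower R M s p) :
    towerRes R M s (some q) r h' (towerRes R M s p q h x) = towerRes R M s p r (h.trans h') x := by
  cases s with
  | zero =>
    have key : coeffMap R (some q) r h' ∘ₗ coeffMap R p q h = coeffMap R p r (h.trans h') :=
      LinearMap.ext (coeffMap_coeffMap R h h')
    exact (LinearMap.rTensor_comp_apply M _ _ x).symm.trans
      (congrArg (fun g => g.rTensor M x) key)
  | succ s => rfl

theorem towerD_zero_apply {p : Option (PrimeSpectrum R)} (x : tower R M 0 p)
    (q : {q : PrimeSpectrum R // FlagAbove R p q}) :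
    (towerD R M 0 p x : ∀ q : {q : PrimeSpectrum R // FlagAbove R p q},
      LocalizedModule q.1.asIdeal.primeCompl (tower R M 0 (some q.1))) q =
      LocalizedModule.mkLinearMap q.1.asIdeal.primeCompl _ (towerRes R M 0 p q.1 q.2 x) :=
  rfl

theorem towerD_succ_apply (s : ℕ) {p : Option (PrimeSpectrum R)} (x : tower R M (s + 1) p)
    (q : {q : PrimeSpectrum R // FlagAbove R p q}) :
    (towerD R M (s + 1) p x : ∀ q : {q : PrimeSpectrum R // FlagAbove R p q},
      LocalizedModule q.1.asIdeal.primeCompl (tower R M (s + 1) (some q.1))) q =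
      LocalizedModule.mkLinearMap q.1.asIdeal.primeCompl _ (towerRes R M (s + 1) p q.1 q.2 x) -
      locMap R q.1.asIdeal.primeCompl (towerD R M s (some q.1))
        ((x : ∀ q : {q : PrimeSpectrum R // FlagAbove R p q},
          LocalizedModule q.1.asIdeal.primeCompl (tower R M s (some q.1))) q) :=
  rfl

theorem towerD_towerRes (s : ℕ) {p : Option (PrimeSpectrum R)} {q : PrimeSpectrum R}
    (h : FlagAbove R p q) (x : tower R M s p) :
    towerD R M s (some q) (towerRes R M s p q h x) =
      towerRes R M (s + 1) p q h (towerD R M s p x) := by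
  cases s with
  | zero =>
    funext r
    exact (towerD_zero_apply R M _ r).trans
      (congrArg _ (towerRes_towerRes R M 0 h r.2 x))
  | succ s => rfl

theorem towerD_towerD (s : ℕ) (p : Option (PrimeSpectrum R)) (x : tower R M s p) :
    towerD R M (s + 1) p (towerD R M s p x) = 0 := by
  induction s generalizing p with
  | zero =>
    funext q
    refine (towerD_succ_apply R M 0 _ q).trans ?_
    rw [towerD_zero_apply, locMap_mkLinearMap, towerD_towerRes, sub_self]
    rfl
  | succ s ih =>
    funext q
    refine (towerD_succ_apply R M (s + 1) _ q).trans ?_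
    rw [towerD_succ_apply, map_sub, locMap_mkLinearMap, towerD_towerRes,
      locMap_locMap_eq_zero _ (fun y => ih (some q.1) y), sub_zero, sub_self]
    rfl

section Functoriality

variable {R M} {N P : Type} [AddCommGroup N] [Module R N] [AddCommGroup P] [Module R P]

/-- The map induced on `tower` by a map of coefficients. -/
noncomputable def towerMap (f : M →ₗ[R] N) : (s : ℕ) → (p : Option (PrimeSpectrum R)) →
    (tower R M s p →ₗ[R] tower R N s p)
  | 0, p => f.lTensor (coeff R p)
  | s + 1, _ => LinearMap.pi fun q =>
      locMap R q.1.asIdeal.primeCompl (towerMap f s (some q.1)) ∘ₗ LinearMap.proj q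

theorem towerMap_succ_apply (f : M →ₗ[R] N) (s : ℕ) {p : Option (PrimeSpectrum R)}
    (x : tower R M (s + 1) p) (q : {q : PrimeSpectrum R // FlagAbove R p q}) :
    (towerMap f (s + 1) p x : ∀ q : {q : PrimeSpectrum R // FlagAbove R p q},
      LocalizedModule q.1.asIdeal.primeCompl (tower R N s (some q.1))) q =
      locMap R q.1.asIdeal.primeCompl (towerMap f s (some q.1))
        ((x : ∀ q : {q : PrimeSpectrum R // FlagAbove R p q},
          LocalizedModule q.1.asIdeal.primeCompl (tower R M s (some q.1))) q) :=
  rfl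

theorem towerRes_towerMap (f : M →ₗ[R] N) (s : ℕ) {p : Option (PrimeSpectrum R)}
    {q : PrimeSpectrum R} (h : FlagAbove R p q) (x : tower R M s p) :
    towerRes R N s p q h (towerMap f s p x) = towerMap f s (some q) (towerRes R M s p q h x) := by
  cases s with
  | zero =>
    exact DFunLike.congr_fun ((LinearMap.rTensor_comp_lTensor _ _ _).trans
      (LinearMap.lTensor_comp_rTensor _ _ _).symm) x
  | succ s => rfl

theorem towerD_towerMap (f : M →ₗ[R] N) (s : ℕ) (p : Option (PrimeSpectrum R))
    (x : tower R M s p) :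
    towerD R N s p (towerMap f s p x) = towerMap f (s + 1) p (towerD R M s p x) := by
  induction s generalizing p with
  | zero =>
    funext q
    refine (towerD_zero_apply R N _ q).trans (Eq.trans ?_ (towerMap_succ_apply f 0 _ q).symm)
    rw [towerD_zero_apply, locMap_mkLinearMap, towerRes_towerMap]
  | succ s ih =>
    funext q
    refine (towerD_succ_apply R N s _ q).trans
      (Eq.trans ?_ (towerMap_succ_apply f (s + 1) _ q).symm)
    rw [towerD_succ_apply, map_sub, locMap_mkLinearMap, towerRes_towerMap, towerMap_succ_apply]
    congr 1
    exact locMap_locMap_congr _ (ih (some q.1)) _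

theorem towerMap_apply_of_smul {f : M →ₗ[R] M} {a : R} (h : ∀ x, f x = a • x) (s : ℕ)
    (p : Option (PrimeSpectrum R)) (x : tower R M s p) : towerMap f s p x = a • x := by
  induction s generalizing p with
  | zero =>
    have : f = a • LinearMap.id := LinearMap.ext h
    change f.lTensor (coeff R p) x = _
    rw [this, LinearMap.lTensor_smul, LinearMap.lTensor_id]
    rfl
  | succ s ih =>
    funext q
    exact locMap_apply_of_smul _ (ih (some q.1)) _

theorem towerMap_surjective {f : M →ₗ[R] N} (hf : Function.Surjective f) (s : ℕ)
    (p : Option (PrimeSpectrum R)) : Function.Surjective (towerMap f s p) := by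
  induction s generalizing p with
  | zero => exact LinearMap.lTensor_surjective _ hf
  | succ s ih =>
    intro y
    choose x hx using fun q => locMap_surjective q.1.asIdeal.primeCompl (ih (some q.1))
      ((y : ∀ q : {q : PrimeSpectrum R // FlagAbove R p q},
          LocalizedModule q.1.asIdeal.primeCompl (tower R N s (some q.1))) q)
    exact ⟨x, funext hx⟩

variable [IsNoetherianRing R]

theorem towerMap_injective {f : M →ₗ[R] N} (hf : Function.Injective f) (s : ℕ)
    (p : Option (PrimeSpectrum R)) : Function.Injective (towerMap f s p) := by
  induction s generalizing p with
  | zero => exact Module.Flat.lTensor_preserves_injective_linearMap f hf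
  | succ s ih =>
    intro x y h
    funext q
    exact locMap_injective _ (ih (some q.1)) (congrFun h q)

theorem towerMap_exact {f : M →ₗ[R] N} {g : N →ₗ[R] P} (h : Function.Exact f g) (s : ℕ)
    (p : Option (PrimeSpectrum R)) : Function.Exact (towerMap f s p) (towerMap g s p) := by
  induction s generalizing p with
  | zero => exact Module.Flat.lTensor_exact _ h
  | succ s ih =>
    intro y
    constructor
    · intro hy
      choose x hx using fun q => (locMap_exact q.1.asIdeal.primeCompl (ih (some q.1)) _).1
        (congrFun hy q)
      exact ⟨x, funext hx⟩
    · rintro ⟨x, rfl⟩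
      funext q
      exact (locMap_exact q.1.asIdeal.primeCompl (ih (some q.1)) _).2 ⟨_, rfl⟩

end Functoriality

section Acyclicity

/-- The element `x` of the global complex is a boundary. -/
def IsTowerBoundary : (s : ℕ) → tower R M s none → Prop
  | 0, x => x = 0
  | s + 1, x => ∃ y, towerD R M s none y = x

/-- The augmented global complex with coefficients in `Λ' ⊗ M` is exact. -/
def TowerAcyclic : Prop :=
  ∀ (s : ℕ) (x : tower R M s none), towerD R M s none x = 0 → IsTowerBoundary R M s x

variable {R M} {N P : Type} [AddCommGroup N] [Module R N] [AddCommGroup P] [Module R P]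

theorem isTowerBoundary_zero (s : ℕ) : IsTowerBoundary R M s 0 := by
  cases s with
  | zero => exact rfl
  | succ s => exact ⟨0, map_zero _⟩

theorem tower_smul_eq_zero {a : R} (h : ∀ m : M, a • m = 0) (s : ℕ)
    (p : Option (PrimeSpectrum R)) (x : tower R M s p) : a • x = 0 := by
  rw [← towerMap_apply_of_smul (f := (0 : M →ₗ[R] M)) (a := a) (fun m => (h m).symm),
    towerMap_apply_of_smul (f := (0 : M →ₗ[R] M)) (a := 0) (fun m => (zero_smul R m).symm),
    zero_smul]

theorem towerAcyclic_of_subsingleton [Subsingleton M] : TowerAcyclic R M := by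
  intro s x _
  have hx : x = 0 := by
    rw [← one_smul R x]
    exact tower_smul_eq_zero (fun m => Subsingleton.elim _ _) s _ x
  rw [hx]
  exact isTowerBoundary_zero s

theorem towerMap_towerMap_eq_zero [IsNoetherianRing R] {f : M →ₗ[R] N} {g : N →ₗ[R] P}
    (h : Function.Exact f g) (s : ℕ) (p : Option (PrimeSpectrum R)) (x : tower R M s p) :
    towerMap g s p (towerMap f s p x) = 0 :=
  (towerMap_exact h s p _).2 ⟨x, rfl⟩

theorem TowerAcyclic.of_exact [IsNoetherianRing R] {f : M →ₗ[R] N} {g : N →ₗ[R] P}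
    (hf : Function.Injective f) (h : Function.Exact f g) (hg : Function.Surjective g)
    (hM : TowerAcyclic R M) (hP : TowerAcyclic R P) : TowerAcyclic R N := by
  intro s z hz
  have hgz := hP s (towerMap g s none z) (by rw [towerD_towerMap, hz, map_zero])
  cases s with
  | zero =>
    obtain ⟨a, rfl⟩ := (towerMap_exact h 0 none z).1 hgz
    have ha : towerD R M 0 none a = 0 := towerMap_injective hf 1 none (by
      rw [← towerD_towerMap, hz, map_zero])
    rw [show a = 0 from hM 0 a ha, map_zero]
    exact isTowerBoundary_zero 0
  | succ s =>
    obtain ⟨c, hc⟩ := hgz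
    obtain ⟨b, rfl⟩ := towerMap_surjective hg s none c
    obtain ⟨a, ha⟩ := (towerMap_exact h (s + 1) none (z - towerD R N s none b)).1 (by
      rw [map_sub, ← hc, towerD_towerMap, sub_self])
    obtain ⟨a', rfl⟩ := hM (s + 1) a (towerMap_injective hf (s + 2) none (by
      rw [← towerD_towerMap, ha, map_sub, hz, towerD_towerD, sub_zero, map_zero]))
    refine ⟨b + towerMap f s none a', ?_⟩
    rw [map_add, towerD_towerMap, ha, add_sub_cancel]

theorem TowerAcyclic.isTowerBoundary_of_towerMap [IsNoetherianRing R] {f : M →ₗ[R] N}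
    {g : N →ₗ[R] P} (hf : Function.Injective f) (h : Function.Exact f g)
    (hg : Function.Surjective g) (hP : TowerAcyclic R P) (s : ℕ) (a : tower R M s none)
    (hfa : IsTowerBoundary R N s (towerMap f s none a)) : IsTowerBoundary R M s a := by
  cases s with
  | zero =>
    exact towerMap_injective hf 0 none ((show towerMap f 0 none a = 0 from hfa).trans
      (map_zero _).symm)
  | succ s =>
    obtain ⟨b, hb⟩ := hfa
    have hgb := hP s (towerMap g s none b) (by
      rw [towerD_towerMap, hb, towerMap_towerMap_eq_zero h])
    suffices ∃ b', towerD R N s none b' = 0 ∧ towerMap g s none (b - b') = 0 by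
      obtain ⟨b', hb', hbb⟩ := this
      obtain ⟨a', ha'⟩ := (towerMap_exact h s none _).1 hbb
      refine ⟨a', towerMap_injective hf (s + 1) none ?_⟩
      rw [← towerD_towerMap, ha', map_sub, hb', sub_zero, hb]
    cases s with
    | zero => exact ⟨0, map_zero _, by rw [sub_zero]; exact hgb⟩
    | succ s =>
      obtain ⟨c, hc⟩ := hgb
      obtain ⟨b', rfl⟩ := towerMap_surjective hg s none c
      refine ⟨towerD R N s none b', towerD_towerD R N s none b', ?_⟩
      rw [map_sub, ← towerD_towerMap, hc, sub_self]

theorem bijective_towerRes_quotient [IsNoetherianRing R] (q : PrimeSpectrum R) :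
    Function.Bijective (towerRes R (R ⧸ q.asIdeal) 0 none q trivial) :=
  bijective_rTensor_toLam' R q

theorem subsingleton_localized_tower_quotient {p q : PrimeSpectrum R} (h : ¬ q ≤ p) (s : ℕ) :
    Subsingleton (LocalizedModule p.asIdeal.primeCompl
      (tower R (R ⧸ q.asIdeal) s (some p))) := by
  obtain ⟨a, haq, hap⟩ := Set.not_subset.1 (show ¬ (q.asIdeal : Set R) ⊆ p.asIdeal from h)
  refine LocalizedModule.subsingleton_iff.2 fun m =>
    ⟨a, hap, tower_smul_eq_zero (fun x => ?_) s _ m⟩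
  obtain ⟨y, rfl⟩ := Submodule.Quotient.mk_surjective _ x
  rw [← Submodule.Quotient.mk_smul]
  exact (Submodule.Quotient.mk_eq_zero _).2 (q.asIdeal.mul_mem_right _ haq)

theorem exists_towerRes_eq [IsNoetherianRing R] (q : PrimeSpectrum R) (s : ℕ)
    (w : tower R (R ⧸ q.asIdeal) s (some q)) :
    ∃ y : tower R (R ⧸ q.asIdeal) s none, towerRes R _ s none q trivial y = w ∧
      (towerD R _ s none y : ∀ p : {p : PrimeSpectrum R // FlagAbove R none p},
        LocalizedModule p.1.asIdeal.primeCompl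
          (tower R (R ⧸ q.asIdeal) s (some p.1))) ⟨q, trivial⟩ =
        LocalizedModule.mkLinearMap q.asIdeal.primeCompl _ w := by
  cases s with
  | zero =>
    obtain ⟨y, rfl⟩ := (bijective_towerRes_quotient q).2 w
    exact ⟨y, rfl, rfl⟩
  | succ s =>
    classical
    let y : ∀ p : {p : PrimeSpectrum R // FlagAbove R none p},
        LocalizedModule p.1.asIdeal.primeCompl (tower R (R ⧸ q.asIdeal) s (some p.1)) :=
      fun p => if h : q < p.1 then
        (w : ∀ p : {p : PrimeSpectrum R // FlagAbove R (some q) p},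
          LocalizedModule p.1.asIdeal.primeCompl (tower R (R ⧸ q.asIdeal) s (some p.1))) ⟨p.1, h⟩
      else 0
    have hy : towerRes R _ (s + 1) none q trivial y = w := funext fun p => dif_pos p.2
    have hq : y ⟨q, trivial⟩ = 0 := dif_neg (lt_irrefl q)
    refine ⟨y, hy, (towerD_succ_apply R _ s (p := none) y ⟨q, trivial⟩).trans ?_⟩
    rw [hq, map_zero, sub_zero, hy]

theorem exists_smul_isTowerBoundary [IsNoetherianRing R] (q : PrimeSpectrum R) (s : ℕ)
    (z : tower R (R ⧸ q.asIdeal) s none) (hz : towerD R _ s none z = 0) :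
    ∃ a ∉ q.asIdeal, IsTowerBoundary R _ s (a • z) := by
  have hzq := congrFun hz ⟨q, trivial⟩
  cases s with
  | zero =>
    obtain ⟨a, ha, hza⟩ := LocalizedModule.mem_ker_mkLinearMap_iff.1 (LinearMap.mem_ker.2 hzq)
    refine ⟨a, ha, (bijective_towerRes_quotient q).1 ?_⟩
    rw [map_smul, hza, map_zero]
  | succ s =>
    replace hzq := (towerD_succ_apply R _ s (p := none) z ⟨q, trivial⟩).symm.trans hzq
    obtain ⟨w, x, hw⟩ : ∃ w x, (z : ∀ p : {p : PrimeSpectrum R // FlagAbove R none p},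
        LocalizedModule p.1.asIdeal.primeCompl
          (tower R (R ⧸ q.asIdeal) s (some p.1))) ⟨q, trivial⟩ = LocalizedModule.mk w x := by
      generalize (z : ∀ p : {p : PrimeSpectrum R // FlagAbove R none p},
        LocalizedModule p.1.asIdeal.primeCompl
          (tower R (R ⧸ q.asIdeal) s (some p.1))) ⟨q, trivial⟩ = v
      induction v using LocalizedModule.induction_on with
      | h w x => exact ⟨w, x, rfl⟩
    rw [hw, locMap_mk] at hzq
    obtain ⟨u, hu⟩ := LocalizedModule.mk_eq.1 (sub_eq_zero.1 hzq)
    obtain ⟨y, hy, hyq⟩ := exists_towerRes_eq q s ((u : R) • w)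
    refine ⟨u * x, (u * x).2, y, ?_⟩
    funext p
    rcases eq_or_ne q p.1 with hp | hp
    · obtain ⟨p, hp'⟩ := p
      obtain rfl : q = p := hp
      refine hyq.trans (Eq.trans ?_ (congrArg (fun v => ((u : R) * (x : R)) • v) hw).symm)
      rw [map_smul, mul_smul]
      refine congrArg (fun v => (u : R) • v) ?_
      exact (LocalizedModule.mk_cancel x w).symm.trans (LocalizedModule.smul'_mk (x : R) w x).symm
    · by_cases hqp : q < p.1
      · have h1 := congrFun (towerD_towerRes R _ s (p := none) (q := q) trivial y) ⟨p.1, hqp⟩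
        refine h1.symm.trans ?_
        rw [hy]
        have h2 : towerD R _ s (some q) ((u : R) • w) =
            ((u : R) * (x : R)) • towerRes R _ (s + 1) none q trivial z := by
          rw [one_smul] at hu
          rw [mul_smul]
          exact (map_smul _ (u : R) w).trans hu.symm
        exact congrFun h2 ⟨p.1, hqp⟩
      · have := subsingleton_localized_tower_quotient (p := p.1) (q := q)
          (fun h => hqp (lt_of_le_of_ne h hp)) s
        exact Subsingleton.elim _ _

section Devissage

variable {I J : Ideal R} {a : R}

theorem mapQ_mulLeft_injective (h : J = Submodule.comap (LinearMap.mulLeft R a) I) :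
    Function.Injective (Submodule.mapQ J I (LinearMap.mulLeft R a) h.le) := by
  rw [← LinearMap.ker_eq_bot, LinearMap.ker_eq_bot']
  intro m hm
  obtain ⟨r, rfl⟩ := Submodule.Quotient.mk_surjective _ m
  rw [Submodule.mapQ_apply, Submodule.Quotient.mk_eq_zero] at hm
  exact (Submodule.Quotient.mk_eq_zero _).2 (h.ge hm)

theorem exact_mapQ_mulLeft_factor (h : J ≤ Submodule.comap (LinearMap.mulLeft R a) I) :
    Function.Exact (Submodule.mapQ J I (LinearMap.mulLeft R a) h)
      (Submodule.factor (le_sup_left : I ≤ I ⊔ Ideal.span {a})) := by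
  intro m
  obtain ⟨r, rfl⟩ := Submodule.Quotient.mk_surjective _ m
  change Submodule.factor _ (Submodule.mkQ _ r) = 0 ↔ _
  rw [Submodule.factor_mk, Submodule.mkQ_apply, Submodule.Quotient.mk_eq_zero, Submodule.mem_sup]
  constructor
  · rintro ⟨i, hi, y, hy, rfl⟩
    obtain ⟨c, rfl⟩ := Ideal.mem_span_singleton.1 hy
    refine ⟨Submodule.Quotient.mk c, ?_⟩
    rw [Submodule.mapQ_apply, Submodule.Quotient.eq]
    simpa using I.neg_mem hi
  · rintro ⟨m, hm⟩
    obtain ⟨c, rfl⟩ := Submodule.Quotient.mk_surjective _ m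
    rw [Submodule.mapQ_apply, Submodule.Quotient.eq] at hm
    refine ⟨r - a * c, ?_, a * c, Ideal.mem_span_singleton.2 ⟨c, rfl⟩, sub_add_cancel _ _⟩
    simpa using I.neg_mem hm

end Devissage

theorem towerAcyclic_quotient [IsNoetherianRing R] (I : Ideal R) : TowerAcyclic R (R ⧸ I) := by
  refine IsNoetherian.induction (P := fun I : Ideal R => TowerAcyclic R (R ⧸ I))
    (fun (I : Ideal R) ih => ?_) I
  have lt_sup {a : R} (ha : a ∉ I) : I < I ⊔ Ideal.span {a} :=
    lt_of_le_of_ne le_sup_left fun h =>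
      ha (h ▸ Ideal.mem_sup_right (Ideal.mem_span_singleton_self a))
  by_cases hI : I.IsPrime
  · intro s z hz
    obtain ⟨a, ha, haz⟩ := exists_smul_isTowerBoundary ⟨I, hI⟩ s z hz
    have hJ : I = Submodule.comap (LinearMap.mulLeft R a) I :=
      le_antisymm (fun r => I.mul_mem_left a) fun r h => (hI.mem_or_mem h).resolve_left ha
    refine (ih _ (lt_sup ha)).isTowerBoundary_of_towerMap (mapQ_mulLeft_injective hJ)
      (exact_mapQ_mulLeft_factor _) (Submodule.factor_surjective _) s z ?_
    rw [towerMap_apply_of_smul (a := a)]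
    · exact haz
    · intro m
      obtain ⟨r, rfl⟩ := Submodule.Quotient.mk_surjective _ m
      rfl
  · by_cases htop : I = ⊤
    · have : Subsingleton (R ⧸ I) := Ideal.Quotient.subsingleton_iff.2 htop
      exact towerAcyclic_of_subsingleton
    · obtain ⟨a, b, hab, ha, hb⟩ : ∃ a b, a * b ∈ I ∧ a ∉ I ∧ b ∉ I := by
        by_contra! h
        exact hI ⟨htop, fun {x y} hxy => or_iff_not_imp_left.2 (h x y hxy)⟩
      let J : Ideal R := Submodule.comap (LinearMap.mulLeft R a) I
      have hIJ : I < J := lt_of_le_of_ne (fun r hr => I.mul_mem_left a hr)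
        fun h => hb (h ▸ (show b ∈ J from hab))
      exact (ih J hIJ).of_exact (mapQ_mulLeft_injective rfl) (exact_mapQ_mulLeft_factor _)
        (Submodule.factor_surjective _) (ih _ (lt_sup ha))

end Acyclicity

end Tower

section Comparison

open scoped TensorProduct

/-- The canonical map `N → N ⊗ (R ⧸ ⊥)`. -/
noncomputable def toTensorBot (N : Type) [AddCommGroup N] [Module R N] :
    N →ₗ[R] N ⊗[R] (R ⧸ (⊥ : Ideal R)) :=
  (TensorProduct.mk R N (R ⧸ (⊥ : Ideal R))).flip (Submodule.Quotient.mk 1)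

theorem toTensorBot_bijective (N : Type) [AddCommGroup N] [Module R N] :
    Function.Bijective (toTensorBot R N) := by
  let e := (TensorProduct.rid R N).symm ≪≫ₗ
    (Submodule.quotEquivOfEqBot (⊥ : Ideal R) rfl).symm.lTensor N
  have : ⇑(toTensorBot R N) = e := by
    funext x
    simp [toTensorBot, e]
  rw [this]
  exact e.bijective

/-- The comparison between the nested adelic modules and the localizations of `tower`. -/
noncomputable def towerOfG : (s : ℕ) → (p : PrimeSpectrum R) → (G R s p →ₗ[R]
      LocalizedModule p.asIdeal.primeCompl (tower R (R ⧸ (⊥ : Ideal R)) s (some p)))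
  | 0, p => locMap R p.asIdeal.primeCompl (toTensorBot R (Lam' R p))
  | s + 1, p => locMap R p.asIdeal.primeCompl
      (LinearMap.pi fun q : {q : PrimeSpectrum R // p < q} => towerOfG s q.1 ∘ₗ LinearMap.proj q)

theorem towerOfG_bijective (s : ℕ) (p : PrimeSpectrum R) :
    Function.Bijective (towerOfG R s p) := by
  induction s generalizing p with
  | zero =>
    exact ⟨locMap_injective _ (toTensorBot_bijective R _).1,
      locMap_surjective _ (toTensorBot_bijective R _).2⟩
  | succ s ih =>
    refine ⟨locMap_injective _ fun x y h => funext fun q => (ih q.1).1 (congrFun h q),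
      locMap_surjective _ fun y => ?_⟩
    choose x hx using fun q : {q : PrimeSpectrum R // p < q} => (ih q.1).2 (y q)
    exact ⟨x, funext hx⟩

/-- The alternating sum of the insertions strictly below the first entry of a flag. -/
noncomputable def insSum (s : ℕ) (p : PrimeSpectrum R) : G R s p →ₗ[R] G R (s + 1) p :=
  ∑ i ∈ Finset.range (s + 1), ((-1 : ℤ) ^ i) • ins R i s p

theorem insSum_zero (p : PrimeSpectrum R) :
    insSum R 0 p = locMap R p.asIdeal.primeCompl (psi R p) := by
  simp only [insSum, zero_add, Finset.sum_range_one, pow_zero, one_smul]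
  rfl

theorem insSum_succ (s : ℕ) (p : PrimeSpectrum R) :
    insSum R (s + 1) p = locMap R p.asIdeal.primeCompl
      (phi R s p - LinearMap.pi fun q : {q : PrimeSpectrum R // p < q} =>
        insSum R s q.1 ∘ₗ LinearMap.proj q) := by
  have h : (LinearMap.pi fun q : {q : PrimeSpectrum R // p < q} =>
        insSum R s q.1 ∘ₗ LinearMap.proj q) = ∑ i ∈ Finset.range (s + 1), ((-1 : ℤ) ^ i) •
      LinearMap.pi fun q : {q : PrimeSpectrum R // p < q} => ins R i s q.1 ∘ₗ LinearMap.proj q := by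
    ext x q
    simp [insSum, LinearMap.sum_apply]
  rw [h, insSum, Finset.sum_range_succ', sub_eq_neg_add, ← Finset.sum_neg_distrib]
  simp only [locMap, map_add, map_sum, pow_succ, mul_neg, mul_one, neg_smul, map_neg, map_zsmul,
    pow_zero, one_smul]
  rfl

theorem towerOfG_insSum (s : ℕ) (p : PrimeSpectrum R) (x : G R s p) :
    towerOfG R (s + 1) p (insSum R s p x) =
      locMap R p.asIdeal.primeCompl (towerD R (R ⧸ (⊥ : Ideal R)) s (some p))
        (towerOfG R s p x) := by
  induction s generalizing p with
  | zero =>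
    rw [insSum_zero]
    refine locMap_locMap_congr _ (fun y => ?_) x
    funext q
    exact locMap_mkLinearMap _ _ _
  | succ s ih =>
    rw [insSum_succ]
    refine locMap_locMap_congr _ (fun y => ?_) x
    funext q
    refine Eq.trans ?_ (towerD_succ_apply R _ s (p := some p) _ q).symm
    refine (map_sub (towerOfG R (s + 1) q.1) _ _).trans ?_
    exact congrArg₂ (· - ·) (locMap_mkLinearMap _ _ _) (ih q.1 (y q))

/-- The comparison between the adelic cochains and the global terms of `tower`. -/
noncomputable def towerOfCochain (s : ℕ) :
    (∀ p : PrimeSpectrum R, G R s p) →ₗ[R] tower R (R ⧸ (⊥ : Ideal R)) (s + 1) none :=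
  LinearMap.pi fun p => towerOfG R s p.1 ∘ₗ LinearMap.proj p.1

theorem towerOfCochain_bijective (s : ℕ) : Function.Bijective (towerOfCochain R s) := by
  refine ⟨fun x y h => funext fun p => (towerOfG_bijective R s p).1 (congrFun h ⟨p, trivial⟩),
    fun y => ?_⟩
  choose x hx using fun p : PrimeSpectrum R => (towerOfG_bijective R s p).2 (y ⟨p, trivial⟩)
  exact ⟨x, funext fun p => hx p.1⟩

theorem adelicD_apply (s : ℕ) (x : ∀ p : PrimeSpectrum R, G R s p) (p : PrimeSpectrum R) :
    adelicD R s x p = delta R s 0 x p - insSum R s p (x p) := by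
  simp only [adelicD, Finset.sum_range_succ' _ (s + 1), sub_eq_neg_add, insSum,
    LinearMap.sum_apply, ← Finset.sum_neg_distrib]
  simp [delta, pow_succ, LinearMap.sum_apply]

theorem towerOfCochain_adelicAug (a : R) :
    towerOfCochain R 0 (adelicAug R a) =
      towerD R (R ⧸ (⊥ : Ideal R)) 0 none (toTensorBot R R a) := by
  funext p
  exact locMap_mkLinearMap _ _ _

theorem towerOfCochain_adelicD (s : ℕ) (x : ∀ p : PrimeSpectrum R, G R s p) :
    towerOfCochain R (s + 1) (adelicD R s x) =
      towerD R (R ⧸ (⊥ : Ideal R)) (s + 1) none (towerOfCochain R s x) := by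
  funext p
  refine Eq.trans ?_ (towerD_succ_apply R _ s (p := none) _ p).symm
  refine (congrArg (towerOfG R (s + 1) p.1) (adelicD_apply R s x p.1)).trans ?_
  refine (map_sub (towerOfG R (s + 1) p.1) _ _).trans ?_
  exact congrArg₂ (· - ·) (locMap_mkLinearMap _ _ _) (towerOfG_insSum R s p.1 (x p.1))

end Comparison

end LocalCoefficients

/-- for a commutative Noetherian catenary ring `R` of finite Krull
dimension, the `local` adelic cochain complex (with coefficients `Λ'` completing
only at closed points) has `H⁰ ≅ R` via the canonical augmentation and `Hˢ = 0`
for `s > 0`. -/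
theorem adelic_cohomology_local_coefficients
    (R : Type) [CommRing R] [IsNoetherianRing R]
    (hcat : IsCatenaryOrder (PrimeSpectrum R))
    (r : ℕ) (hdim : ringKrullDim R = r) :
    Function.Injective (adelicAug R) ∧
    Function.Exact (adelicAug R) (adelicD R 0) ∧
    ∀ s : ℕ, Function.Exact (adelicD R s) (adelicD R (s + 1)) := by
  have hac := towerAcyclic_quotient (⊥ : Ideal R)
  have hinj (s : ℕ) := (towerOfCochain_bijective R s).1
  refine ⟨?_, ?_, ?_⟩
  · rw [← LinearMap.ker_eq_bot, LinearMap.ker_eq_bot']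
    intro a ha
    refine (toTensorBot_bijective R R).1 (Eq.trans ?_ (map_zero _).symm)
    exact hac 0 _ (by rw [← towerOfCochain_adelicAug, ha, map_zero])
  · intro x
    constructor
    · intro hx
      obtain ⟨y, hy⟩ := hac 1 (towerOfCochain R 0 x) (by
        rw [← towerOfCochain_adelicD, hx, map_zero])
      obtain ⟨a, rfl⟩ := (toTensorBot_bijective R R).2 y
      exact ⟨a, hinj 0 ((towerOfCochain_adelicAug R a).trans hy)⟩
    · rintro ⟨a, rfl⟩
      refine hinj 1 ?_
      rw [towerOfCochain_adelicD, towerOfCochain_adelicAug, map_zero]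
      exact towerD_towerD R (R ⧸ (⊥ : Ideal R)) 0 none (toTensorBot R R a)
  · intro s x
    constructor
    · intro hx
      obtain ⟨y, hy⟩ := hac (s + 2) (towerOfCochain R (s + 1) x) (by
        rw [← towerOfCochain_adelicD, hx, map_zero])
      obtain ⟨a, rfl⟩ := (towerOfCochain_bijective R s).2 y
      exact ⟨a, hinj (s + 1) ((towerOfCochain_adelicD R s a).trans hy)⟩
    · rintro ⟨a, rfl⟩
      refine hinj (s + 2) ?_
      rw [towerOfCochain_adelicD, towerOfCochain_adelicD, towerD_towerD, map_zero]
end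

section
/- Let K be a finite simplicial complex and let N be a dual coefficient system on K, i.e. a functor from the poset of faces of K (ordered by inclusion) to abelian groups. Let K' be the order (flag) complex of K, whose s-simplices are chains σ0 ⊋ σ1 ⊋ ⋯ ⊋ σs of faces of K, and let N_* be the induced dual coefficient system on K' given by N_*(σ0 ⊋ ⋯ ⊋ σs) = N(σ0). Then the simplicial cohomology of K with coefficients in N is isomorphic to the simplicial cohomology of K' with coefficients in N_*: H^*_simp(K; N) ≅ H^*_simp(K'; N_*). -/
section Subdivision

variable {V : Type} [LinearOrder V] (K : Set (Finset V))

/-- The faces of the simplicial complex `K`. -/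
def Face : Type := {σ : Finset V // σ ∈ K}

variable (Nobj : Face K → Type) [∀ σ, AddCommGroup (Nobj σ)]
  (Nmap : ∀ {τ σ : Face K}, τ.1 ⊆ σ.1 → (Nobj τ →+ Nobj σ))

/-- The group of simplicial `s`-cochains of `K` with coefficients in the
dual coefficient system `N`. -/
abbrev SimpCochain (s : ℕ) : Type :=
  ∀ σ : {σ : Face K // σ.1.card = s + 1}, Nobj σ.1

/-- The simplicial coboundary `δf(σ) = Σᵢ (-1)ⁱ N(∂ᵢσ → σ)(f(∂ᵢσ))`. -/
noncomputable def simpCoboundary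
    (hdown : ∀ σ ∈ K, ∀ τ, τ ⊆ σ → τ.Nonempty → τ ∈ K) (s : ℕ) :
    SimpCochain K Nobj s →ₗ[ℤ] SimpCochain K Nobj (s + 1) :=
  LinearMap.pi fun σ =>
    ∑ i : Fin (s + 2),
      ((-1 : ℤ) ^ (i : ℕ)) •
        ((Nmap (Finset.erase_subset _ _)).toIntLinearMap ∘ₗ
          LinearMap.proj
            (⟨⟨σ.1.1.erase (σ.1.1.orderIsoOfFin σ.2 i).1,
                hdown σ.1.1 σ.1.2 _ (Finset.erase_subset _ _)
                  (Finset.card_pos.mp (by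
                    rw [Finset.card_erase_of_mem (σ.1.1.orderIsoOfFin σ.2 i).2, σ.2]
                    omega))⟩,
              by
                rw [Finset.card_erase_of_mem (σ.1.1.orderIsoOfFin σ.2 i).2, σ.2]
                omega⟩ :
              {τ : Face K // τ.1.card = s + 1}))

/-- `s`-simplices of the order (flag) complex `K'`: strictly decreasing chains of
`s+1` faces of `K`. -/
def FlagSimplex (s : ℕ) : Type :=
  {c : Fin (s + 1) → Face K // StrictAnti fun i => (c i).1}

/-- The group of simplicial `s`-cochains of the order complex `K'` with coefficients
in the induced dual coefficient system `N_*(σ₀ ⊋ ⋯ ⊋ σₛ) = N(σ₀)`. -/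
abbrev FlagCochain (s : ℕ) : Type :=
  ∀ c : FlagSimplex K s, Nobj (c.1 0)

/-- The simplicial coboundary of the order complex `K'` with coefficients in `N_*`. -/
noncomputable def flagCoboundary (s : ℕ) :
    FlagCochain K Nobj s →ₗ[ℤ] FlagCochain K Nobj (s + 1) :=
  LinearMap.pi fun c =>
    ∑ i : Fin (s + 2),
      ((-1 : ℤ) ^ (i : ℕ)) •
        ((Nmap ((c.2.antitone (Fin.zero_le _) :
            (c.1 (Fin.succAbove i 0)).1 ≤ (c.1 0).1))).toIntLinearMap ∘ₗ
          LinearMap.proj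
            (⟨fun j => c.1 (Fin.succAbove i j),
              c.2.comp_strictMono (Fin.strictMono_succAbove i)⟩ : FlagSimplex K s))

end Subdivision

section CarriedMaps

open Finsupp

variable {P : Type} [Preorder P]

/-- The integral chains on `B` all of whose basis elements have label at most `p`. -/
noncomputable def below {B : Type} (t : B → P) (p : P) : Submodule ℤ (B →₀ ℤ) :=
  Finsupp.supported ℤ ℤ {b | t b ≤ p}

theorem single_mem_below {B : Type} {t : B → P} {p : P} {b : B} (h : t b ≤ p) (n : ℤ) :
    single b n ∈ below t p :=
  Finsupp.single_mem_supported ℤ n h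

theorem below_mono {B : Type} (t : B → P) {p q : P} (h : p ≤ q) : below t p ≤ below t q :=
  Finsupp.supported_mono fun _ hb => le_trans hb h

theorem below_le {B : Type} {t : B → P} {p : P} {S : Submodule ℤ (B →₀ ℤ)}
    (h : ∀ b, t b ≤ p → single b 1 ∈ S) : below t p ≤ S := by
  rw [below, Finsupp.supported_eq_span_single, Submodule.span_le]
  rintro _ ⟨b, hb, rfl⟩
  exact h b hb

theorem eqOn_below {B M : Type} [AddCommGroup M] {t : B → P} {p : P}
    {f g : (B →₀ ℤ) →ₗ[ℤ] M} (h : ∀ b, t b ≤ p → f (single b 1) = g (single b 1))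
    {x : B →₀ ℤ} (hx : x ∈ below t p) : f x = g x :=
  below_le (S := LinearMap.eqLocus f g) h hx

/-- A map of integral chains is carried if it does not increase labels. -/
def Carried {B B' : Type} (t : B → P) (t' : B' → P) (m : (B →₀ ℤ) →ₗ[ℤ] (B' →₀ ℤ)) : Prop :=
  ∀ p, ∀ x ∈ below t p, m x ∈ below t' p

theorem carried_of_single {B B' : Type} {t : B → P} {t' : B' → P}
    {m : (B →₀ ℤ) →ₗ[ℤ] (B' →₀ ℤ)} (h : ∀ b, m (single b 1) ∈ below t' (t b)) :
    Carried t t' m := fun p _ hx =>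
  below_le (S := (below t' p).comap m) (fun b hb => below_mono t' hb (h b)) hx

theorem Carried.single {B B' : Type} {t : B → P} {t' : B' → P}
    {m : (B →₀ ℤ) →ₗ[ℤ] (B' →₀ ℤ)} (h : Carried t t' m) (b : B) :
    m (single b 1) ∈ below t' (t b) :=
  h _ _ (single_mem_below le_rfl 1)

theorem Carried.comp {B B' B'' : Type} {t : B → P} {t' : B' → P} {t'' : B'' → P}
    {m : (B →₀ ℤ) →ₗ[ℤ] (B' →₀ ℤ)} {m' : (B' →₀ ℤ) →ₗ[ℤ] (B'' →₀ ℤ)}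
    (h' : Carried t' t'' m') (h : Carried t t' m) : Carried t t'' (m' ∘ₗ m) :=
  fun p x hx => h' p _ (h p x hx)

variable {N : P → Type} [∀ p, AddCommGroup (N p)] (Nm : ∀ {p q : P}, p ≤ q → (N p →+ N q))

open Classical in
/-- Evaluation of cochains with coefficients in `N` on integral chains labelled below `p`. -/
noncomputable def evaluate {B : Type} (t : B → P) (p : P) :
    (B →₀ ℤ) →ₗ[ℤ] ((∀ b, N (t b)) →ₗ[ℤ] N p) :=
  Finsupp.linearCombination ℤ fun b =>
    if h : t b ≤ p then (Nm h).toIntLinearMap ∘ₗ LinearMap.proj b else 0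

theorem evaluate_single {B : Type} {t : B → P} {p : P} {b : B} (h : t b ≤ p)
    (f : ∀ b, N (t b)) : evaluate Nm t p (single b 1) f = Nm h (f b) := by
  simp [evaluate, h]

/-- The map on cochains with coefficients in `N` induced by a map of integral chains. -/
noncomputable def pull {B B' : Type} (t : B → P) (t' : B' → P)
    (m : (B →₀ ℤ) →ₗ[ℤ] (B' →₀ ℤ)) : (∀ b, N (t' b)) →ₗ[ℤ] (∀ b, N (t b)) :=
  LinearMap.pi fun b => evaluate Nm t' (t b) (m (single b 1))

theorem pull_apply {B B' : Type} (t : B → P) (t' : B' → P)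
    (m : (B →₀ ℤ) →ₗ[ℤ] (B' →₀ ℤ)) (f : ∀ b, N (t' b)) (b : B) :
    pull Nm t t' m f b = evaluate Nm t' (t b) (m (single b 1)) f := rfl

theorem pull_add {B B' : Type} (t : B → P) (t' : B' → P) (m m' : (B →₀ ℤ) →ₗ[ℤ] (B' →₀ ℤ)) :
    pull Nm t t' (m + m') = pull Nm t t' m + pull Nm t t' m' := by
  ext f b
  simp [pull_apply]

theorem pull_sub {B B' : Type} (t : B → P) (t' : B' → P) (m m' : (B →₀ ℤ) →ₗ[ℤ] (B' →₀ ℤ)) :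
    pull Nm t t' (m - m') = pull Nm t t' m - pull Nm t t' m' := by
  ext f b
  simp [pull_apply]

theorem pull_id (hid : ∀ p : P, Nm (le_refl p) = AddMonoidHom.id (N p)) {B : Type} (t : B → P) :
    pull Nm t t LinearMap.id = LinearMap.id := by
  ext f b
  simp [pull_apply, evaluate_single Nm (le_refl (t b)), hid]

theorem map_evaluate
    (hcomp : ∀ (p q r : P) (h1 : p ≤ q) (h2 : q ≤ r), (Nm h2).comp (Nm h1) = Nm (h1.trans h2))
    {B : Type} {t : B → P} {p q : P} (h : p ≤ q) (f : ∀ b, N (t b)) {x : B →₀ ℤ}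
    (hx : x ∈ below t p) : Nm h (evaluate Nm t p x f) = evaluate Nm t q x f := by
  refine eqOn_below (f := (Nm h).toIntLinearMap ∘ₗ (evaluate Nm t p).flip f)
    (g := (evaluate Nm t q).flip f) (fun b hb => ?_) hx
  simp only [LinearMap.comp_apply, LinearMap.flip_apply, AddMonoidHom.coe_toIntLinearMap]
  rw [evaluate_single Nm hb, evaluate_single Nm (hb.trans h), ← hcomp _ _ _ hb h]
  rfl

theorem evaluate_pull
    (hcomp : ∀ (p q r : P) (h1 : p ≤ q) (h2 : q ≤ r), (Nm h2).comp (Nm h1) = Nm (h1.trans h2))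
    {B B' : Type} {t : B → P} {t' : B' → P} {m : (B →₀ ℤ) →ₗ[ℤ] (B' →₀ ℤ)}
    (hm : Carried t t' m) {p : P} (f : ∀ b, N (t' b)) {x : B →₀ ℤ} (hx : x ∈ below t p) :
    evaluate Nm t p x (pull Nm t t' m f) = evaluate Nm t' p (m x) f := by
  refine eqOn_below (f := (evaluate Nm t p).flip (pull Nm t t' m f))
    (g := (evaluate Nm t' p).flip f ∘ₗ m) (fun b hb => ?_) hx
  simp only [LinearMap.comp_apply, LinearMap.flip_apply]
  rw [evaluate_single Nm hb, pull_apply, map_evaluate Nm hcomp hb f (hm.single b)]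

theorem pull_comp
    (hcomp : ∀ (p q r : P) (h1 : p ≤ q) (h2 : q ≤ r), (Nm h2).comp (Nm h1) = Nm (h1.trans h2))
    {B B' B'' : Type} {t : B → P} {t' : B' → P} {t'' : B'' → P}
    {m : (B →₀ ℤ) →ₗ[ℤ] (B' →₀ ℤ)} {m' : (B' →₀ ℤ) →ₗ[ℤ] (B'' →₀ ℤ)}
    (hm' : Carried t' t'' m') (hm : Carried t t' m) :
    pull Nm t t'' (m' ∘ₗ m) = pull Nm t t' m ∘ₗ pull Nm t' t'' m' := by
  refine LinearMap.ext fun f => funext fun b => ?_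
  rw [LinearMap.comp_apply, pull_apply, pull_apply, evaluate_pull Nm hcomp hm' f (hm.single b)]
  rfl

end CarriedMaps

section ConeComplex

open Finsupp

/-- The sum of the coefficients of an integral chain. -/
noncomputable def augmentation (B : Type) : (B →₀ ℤ) →ₗ[ℤ] ℤ :=
  Finsupp.linearCombination ℤ fun _ => 1

theorem augmentation_single {B : Type} (b : B) : augmentation B (single b 1) = 1 := by
  simp [augmentation]

/-- A based integral chain complex labelled by a preorder, together with a contracting cone on
the subcomplex of chains labelled below each `p`, such that each simplex of positive dimension is
a cone over a simplex with apex its label. -/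
structure ConeComplex (P : Type) [Preorder P] where
  /-- The simplices of each dimension. -/
  Simplex : ℕ → Type
  /-- The label of a simplex. -/
  top : ∀ s, Simplex s → P
  /-- The boundary map. -/
  d : ∀ s, (Simplex (s + 1) →₀ ℤ) →ₗ[ℤ] (Simplex s →₀ ℤ)
  /-- The apex of the cone on the chains below `p`. -/
  apex : P → Simplex 0
  /-- The cone operator on the chains below `p`. -/
  cone : ∀ s, P → (Simplex s →₀ ℤ) →ₗ[ℤ] (Simplex (s + 1) →₀ ℤ)
  carried_d : ∀ s, Carried (top (s + 1)) (top s) (d s)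
  apex_le : ∀ p, top 0 (apex p) ≤ p
  cone_single_mem : ∀ s p b, top s b ≤ p → cone s p (single b 1) ∈ below (top (s + 1)) p
  d_cone_single_zero : ∀ p b, top 0 b ≤ p →
    d 0 (cone 0 p (single b 1)) = single b 1 - single (apex p) 1
  d_cone_single_succ : ∀ s p b, top (s + 1) b ≤ p →
    d (s + 1) (cone (s + 1) p (single b 1)) = single b 1 - cone s p (d s (single b 1))
  exists_eq_cone : ∀ s (b : Simplex (s + 1)), ∃ b' : Simplex s,
    top s b' ≤ top (s + 1) b ∧ cone s (top (s + 1) b) (single b' 1) = single b 1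

namespace ConeComplex

variable {P : Type} [Preorder P] (X Y : ConeComplex P)

theorem cone_mem (s : ℕ) {p : P} {x : X.Simplex s →₀ ℤ} (hx : x ∈ below (X.top s) p) :
    X.cone s p x ∈ below (X.top (s + 1)) p :=
  below_le (S := (below (X.top (s + 1)) p).comap (X.cone s p)) (X.cone_single_mem s p) hx

theorem d_cone_zero {p : P} {x : X.Simplex 0 →₀ ℤ} (hx : x ∈ below (X.top 0) p) :
    X.d 0 (X.cone 0 p x) = x - augmentation _ x • single (X.apex p) 1 := by
  refine eqOn_below (f := X.d 0 ∘ₗ X.cone 0 p)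
    (g := LinearMap.id - (augmentation _).smulRight (single (X.apex p) 1)) (fun b hb => ?_) hx
  simp [X.d_cone_single_zero p b hb, augmentation_single]

theorem d_cone_succ {s : ℕ} {p : P} {x : X.Simplex (s + 1) →₀ ℤ}
    (hx : x ∈ below (X.top (s + 1)) p) :
    X.d (s + 1) (X.cone (s + 1) p x) = x - X.cone s p (X.d s x) := by
  refine eqOn_below (f := X.d (s + 1) ∘ₗ X.cone (s + 1) p)
    (g := LinearMap.id - X.cone s p ∘ₗ X.d s) (fun b hb => ?_) hx
  simp [X.d_cone_single_succ s p b hb]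

theorem augmentation_d (x : X.Simplex 1 →₀ ℤ) : augmentation _ (X.d 0 x) = 0 := by
  suffices h : augmentation _ ∘ₗ X.d 0 = 0 from LinearMap.congr_fun h x
  refine Finsupp.lhom_ext' fun b => LinearMap.ext_ring ?_
  obtain ⟨b', hb', hb⟩ := X.exists_eq_cone 0 b
  simp only [LinearMap.comp_apply, lsingle_apply, LinearMap.zero_apply]
  rw [← hb, X.d_cone_single_zero _ _ hb', map_sub, augmentation_single, augmentation_single,
    sub_self]

theorem d_d (s : ℕ) (x : X.Simplex (s + 2) →₀ ℤ) : X.d s (X.d (s + 1) x) = 0 := by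
  suffices h : X.d s ∘ₗ X.d (s + 1) = 0 from LinearMap.congr_fun h x
  clear x
  induction s with
  | zero =>
    refine Finsupp.lhom_ext' fun b => LinearMap.ext_ring ?_
    obtain ⟨b', hb', hb⟩ := X.exists_eq_cone 1 b
    simp only [LinearMap.comp_apply, lsingle_apply, LinearMap.zero_apply]
    rw [← hb, X.d_cone_single_succ _ _ _ hb', map_sub,
      X.d_cone_zero (X.carried_d 0 _ _ (single_mem_below hb' 1)), augmentation_d]
    simp
  | succ s ih =>
    refine Finsupp.lhom_ext' fun b => LinearMap.ext_ring ?_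
    obtain ⟨b', hb', hb⟩ := X.exists_eq_cone (s + 2) b
    have h0 : X.d s (X.d (s + 1) (single b' 1)) = 0 := LinearMap.congr_fun ih _
    simp only [LinearMap.comp_apply, lsingle_apply, LinearMap.zero_apply]
    rw [← hb, X.d_cone_single_succ _ _ _ hb', map_sub,
      X.d_cone_succ (X.carried_d _ _ _ (single_mem_below hb' 1)), h0]
    simp

/-- The comparison chain map between two cone complexes, built by coning off boundaries. -/
noncomputable def compare : ∀ s, (X.Simplex s →₀ ℤ) →ₗ[ℤ] (Y.Simplex s →₀ ℤ)
  | 0 => Finsupp.linearCombination ℤ fun b => single (Y.apex (X.top 0 b)) 1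
  | s + 1 => Finsupp.linearCombination ℤ fun b =>
      Y.cone s (X.top (s + 1) b) (compare s (X.d s (single b 1)))

theorem compare_zero_single (b : X.Simplex 0) :
    compare X Y 0 (single b 1) = single (Y.apex (X.top 0 b)) 1 := by
  simp [compare]

theorem compare_succ_single (s : ℕ) (b : X.Simplex (s + 1)) :
    compare X Y (s + 1) (single b 1) =
      Y.cone s (X.top (s + 1) b) (compare X Y s (X.d s (single b 1))) := by
  simp [compare]

theorem carried_compare (s : ℕ) : Carried (X.top s) (Y.top s) (compare X Y s) := by
  induction s with
  | zero =>
    refine carried_of_single fun b => ?_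
    rw [compare_zero_single]
    exact single_mem_below (Y.apex_le _) 1
  | succ s ih =>
    refine carried_of_single fun b => ?_
    rw [compare_succ_single]
    exact Y.cone_mem s (ih _ _ ((X.carried_d s).single b))

theorem augmentation_compare (x : X.Simplex 0 →₀ ℤ) :
    augmentation _ (compare X Y 0 x) = augmentation _ x := by
  suffices h : augmentation _ ∘ₗ compare X Y 0 = augmentation _ from LinearMap.congr_fun h x
  refine Finsupp.lhom_ext' fun b => LinearMap.ext_ring ?_
  simp [compare_zero_single, augmentation_single]

theorem d_comp_compare (s : ℕ) :
    Y.d s ∘ₗ compare X Y (s + 1) = compare X Y s ∘ₗ X.d s := by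
  induction s with
  | zero =>
    refine Finsupp.lhom_ext' fun b => LinearMap.ext_ring ?_
    simp only [LinearMap.comp_apply, lsingle_apply]
    rw [compare_succ_single,
      Y.d_cone_zero (carried_compare X Y 0 _ _ ((X.carried_d 0).single b)),
      augmentation_compare, augmentation_d, zero_smul, sub_zero]
  | succ s ih =>
    refine Finsupp.lhom_ext' fun b => LinearMap.ext_ring ?_
    have h0 := LinearMap.congr_fun ih (X.d (s + 1) (single b 1))
    simp only [LinearMap.comp_apply, X.d_d, map_zero] at h0
    simp only [LinearMap.comp_apply, lsingle_apply]
    rw [compare_succ_single,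
      Y.d_cone_succ (carried_compare X Y _ _ _ ((X.carried_d _).single b)), h0, map_zero, sub_zero]

/-- The chain homotopy between two carried chain maps, built by coning off. -/
noncomputable def homotopy (f : ∀ s, (X.Simplex s →₀ ℤ) →ₗ[ℤ] (X.Simplex s →₀ ℤ)) :
    ∀ s, (X.Simplex s →₀ ℤ) →ₗ[ℤ] (X.Simplex (s + 1) →₀ ℤ)
  | 0 => Finsupp.linearCombination ℤ fun b =>
      X.cone 0 (X.top 0 b) (f 0 (single b 1) - single b 1)
  | s + 1 => Finsupp.linearCombination ℤ fun b =>
      X.cone (s + 1) (X.top (s + 1) b)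
        (f (s + 1) (single b 1) - single b 1 - homotopy f s (X.d s (single b 1)))

section

variable {X} {f : ∀ s, (X.Simplex s →₀ ℤ) →ₗ[ℤ] (X.Simplex s →₀ ℤ)}

theorem homotopy_zero_single (b : X.Simplex 0) :
    X.homotopy f 0 (single b 1) = X.cone 0 (X.top 0 b) (f 0 (single b 1) - single b 1) := by
  simp [homotopy]

theorem homotopy_succ_single (s : ℕ) (b : X.Simplex (s + 1)) :
    X.homotopy f (s + 1) (single b 1) = X.cone (s + 1) (X.top (s + 1) b)
      (f (s + 1) (single b 1) - single b 1 - X.homotopy f s (X.d s (single b 1))) := by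
  simp [homotopy]

theorem carried_homotopy (hf : ∀ s, Carried (X.top s) (X.top s) (f s)) (s : ℕ) :
    Carried (X.top s) (X.top (s + 1)) (X.homotopy f s) := by
  induction s with
  | zero =>
    refine carried_of_single fun b => ?_
    rw [homotopy_zero_single]
    exact X.cone_mem 0 (sub_mem ((hf 0).single b) (single_mem_below le_rfl 1))
  | succ s ih =>
    refine carried_of_single fun b => ?_
    rw [homotopy_succ_single]
    exact X.cone_mem _ (sub_mem (sub_mem ((hf _).single b) (single_mem_below le_rfl 1))
      (ih _ _ ((X.carried_d s).single b)))

theorem d_comp_homotopy_zero (hf : ∀ s, Carried (X.top s) (X.top s) (f s))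
    (haug : ∀ x, augmentation _ (f 0 x) = augmentation _ x) :
    X.d 0 ∘ₗ X.homotopy f 0 = f 0 - LinearMap.id := by
  refine Finsupp.lhom_ext' fun b => LinearMap.ext_ring ?_
  simp only [LinearMap.comp_apply, lsingle_apply, LinearMap.sub_apply, LinearMap.id_apply]
  rw [homotopy_zero_single,
    X.d_cone_zero (sub_mem ((hf 0).single b) (single_mem_below le_rfl 1)), map_sub, haug,
    sub_self, zero_smul, sub_zero]

theorem d_comp_homotopy_succ (hf : ∀ s, Carried (X.top s) (X.top s) (f s))
    (haug : ∀ x, augmentation _ (f 0 x) = augmentation _ x)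
    (hd : ∀ s, X.d s ∘ₗ f (s + 1) = f s ∘ₗ X.d s) (s : ℕ) :
    X.d (s + 1) ∘ₗ X.homotopy f (s + 1) + X.homotopy f s ∘ₗ X.d s = f (s + 1) - LinearMap.id := by
  have key : ∀ b, X.d s (X.homotopy f s (X.d s (single b 1))) =
      f s (X.d s (single b 1)) - X.d s (single b 1) := by
    intro b
    cases s with
    | zero => exact LinearMap.congr_fun (d_comp_homotopy_zero hf haug) _
    | succ s =>
      have := LinearMap.congr_fun (d_comp_homotopy_succ hf haug hd s) (X.d (s + 1) (single b 1))
      simpa [X.d_d] using this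
  refine Finsupp.lhom_ext' fun b => LinearMap.ext_ring ?_
  have h1 := LinearMap.congr_fun (hd s) (single b 1)
  simp only [LinearMap.comp_apply] at h1
  simp only [LinearMap.comp_apply, lsingle_apply, LinearMap.sub_apply, LinearMap.id_apply,
    LinearMap.add_apply]
  rw [homotopy_succ_single,
    X.d_cone_succ (sub_mem (sub_mem ((hf _).single b) (single_mem_below le_rfl 1))
      (carried_homotopy hf s _ _ ((X.carried_d s).single b))), map_sub (X.d s),
    map_sub (X.d s), key, h1]
  simp

end

/-- The round trip of comparison maps. -/
noncomputable def roundTrip (s : ℕ) : (X.Simplex s →₀ ℤ) →ₗ[ℤ] (X.Simplex s →₀ ℤ) :=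
  compare Y X s ∘ₗ compare X Y s

theorem carried_roundTrip (s : ℕ) : Carried (X.top s) (X.top s) (roundTrip X Y s) :=
  (carried_compare Y X s).comp (carried_compare X Y s)

theorem augmentation_roundTrip (x : X.Simplex 0 →₀ ℤ) :
    augmentation _ (roundTrip X Y 0 x) = augmentation _ x := by
  rw [roundTrip, LinearMap.comp_apply, augmentation_compare, augmentation_compare]

theorem d_comp_roundTrip (s : ℕ) :
    X.d s ∘ₗ roundTrip X Y (s + 1) = roundTrip X Y s ∘ₗ X.d s := by
  rw [roundTrip, roundTrip, ← LinearMap.comp_assoc, d_comp_compare, LinearMap.comp_assoc,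
    d_comp_compare, LinearMap.comp_assoc]

variable {N : P → Type} [∀ p, AddCommGroup (N p)] (Nm : ∀ {p q : P}, p ≤ q → (N p →+ N q))

/-- The coboundary on cochains with coefficients in `N`. -/
noncomputable def coboundary (s : ℕ) :
    (∀ b, N (X.top s b)) →ₗ[ℤ] (∀ b, N (X.top (s + 1) b)) :=
  pull Nm (X.top (s + 1)) (X.top s) (X.d s)

/-- The comparison map on cochains with coefficients in `N`. -/
noncomputable def pullCompare (s : ℕ) : (∀ b, N (Y.top s b)) →ₗ[ℤ] (∀ b, N (X.top s b)) :=
  pull Nm (X.top s) (Y.top s) (compare X Y s)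

variable (hid : ∀ p : P, Nm (le_refl p) = AddMonoidHom.id (N p))
  (hcomp : ∀ (p q r : P) (h1 : p ≤ q) (h2 : q ≤ r), (Nm h2).comp (Nm h1) = Nm (h1.trans h2))

include hcomp in
theorem coboundary_pullCompare (s : ℕ) (f : ∀ b, N (Y.top s b)) :
    X.coboundary Nm s (pullCompare X Y Nm s f) =
      pullCompare X Y Nm (s + 1) (Y.coboundary Nm s f) := by
  have h := congrArg (pull Nm (X.top (s + 1)) (Y.top s)) (d_comp_compare X Y s)
  rw [pull_comp Nm hcomp (Y.carried_d s) (carried_compare X Y (s + 1)),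
    pull_comp Nm hcomp (carried_compare X Y s) (X.carried_d s)] at h
  exact (LinearMap.congr_fun h f).symm

include hid hcomp in
theorem pullCompare_pullCompare_zero (f : ∀ b, N (X.top 0 b)) (hf : X.coboundary Nm 0 f = 0) :
    pullCompare X Y Nm 0 (pullCompare Y X Nm 0 f) = f := by
  have h := congrArg (pull Nm (X.top 0) (X.top 0)) (d_comp_homotopy_zero
    (carried_roundTrip X Y) (augmentation_roundTrip X Y))
  rw [pull_comp Nm hcomp (X.carried_d 0) (carried_homotopy (carried_roundTrip X Y) 0), pull_sub,
    pull_id Nm hid, roundTrip,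
    pull_comp Nm hcomp (carried_compare Y X 0) (carried_compare X Y 0)] at h
  have h' := LinearMap.congr_fun h f
  simp only [LinearMap.comp_apply, LinearMap.sub_apply, LinearMap.id_apply] at h'
  rw [coboundary] at hf
  rw [hf, map_zero] at h'
  exact (sub_eq_zero.mp h'.symm)

include hid hcomp in
theorem pullCompare_pullCompare_succ (s : ℕ) (f : ∀ b, N (X.top (s + 1) b))
    (hf : X.coboundary Nm (s + 1) f = 0) :
    pullCompare X Y Nm (s + 1) (pullCompare Y X Nm (s + 1) f) - f ∈
      LinearMap.range (X.coboundary Nm s) := by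
  have h := congrArg (pull Nm (X.top (s + 1)) (X.top (s + 1))) (d_comp_homotopy_succ
    (carried_roundTrip X Y) (augmentation_roundTrip X Y) (d_comp_roundTrip X Y) s)
  rw [pull_add, pull_comp Nm hcomp (X.carried_d (s + 1))
      (carried_homotopy (carried_roundTrip X Y) (s + 1)),
    pull_comp Nm hcomp (carried_homotopy (carried_roundTrip X Y) s) (X.carried_d s), pull_sub,
    pull_id Nm hid, roundTrip,
    pull_comp Nm hcomp (carried_compare Y X (s + 1)) (carried_compare X Y (s + 1))] at h
  have h' := LinearMap.congr_fun h f
  simp only [LinearMap.comp_apply, LinearMap.sub_apply, LinearMap.id_apply,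
    LinearMap.add_apply] at h'
  rw [coboundary] at hf
  rw [hf, map_zero, zero_add] at h'
  exact ⟨_, h'⟩

/-- The degree `s + 1` cohomology of a cone complex with coefficients in `N`. -/
abbrev Cohomology (s : ℕ) : Type :=
  LinearMap.ker (X.coboundary Nm (s + 1)) ⧸
    Submodule.comap (LinearMap.ker (X.coboundary Nm (s + 1))).subtype
      (LinearMap.range (X.coboundary Nm s))

/-- The comparison map on cocycles. -/
noncomputable def cocycleMap (s : ℕ) :
    LinearMap.ker (Y.coboundary Nm s) →ₗ[ℤ] LinearMap.ker (X.coboundary Nm s) :=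
  (pullCompare X Y Nm s).restrict fun f hf => by
    rw [LinearMap.mem_ker] at hf ⊢
    rw [coboundary_pullCompare X Y Nm hcomp, hf, map_zero]

/-- The comparison map on cohomology. -/
noncomputable def cohomologyMap (s : ℕ) : Y.Cohomology Nm s →ₗ[ℤ] X.Cohomology Nm s :=
  Submodule.mapQ _ _ (cocycleMap X Y Nm hcomp (s + 1)) <| by
    rintro ⟨_, hf⟩ ⟨g, rfl⟩
    exact ⟨pullCompare X Y Nm s g, coboundary_pullCompare X Y Nm hcomp s g⟩

include hid in
theorem cohomologyMap_comp (s : ℕ) :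
    cohomologyMap X Y Nm hcomp s ∘ₗ cohomologyMap Y X Nm hcomp s = LinearMap.id := by
  refine Submodule.linearMap_qext _ (LinearMap.ext fun f => ?_)
  refine (Submodule.Quotient.eq _).mpr ?_
  exact pullCompare_pullCompare_succ X Y Nm hid hcomp s f.1 f.2

/-- Cone complexes over the same preorder have isomorphic cocycles in degree zero. -/
noncomputable def cocycleEquiv :
    LinearMap.ker (X.coboundary Nm 0) ≃ₗ[ℤ] LinearMap.ker (Y.coboundary Nm 0) :=
  LinearEquiv.ofLinearMap (cocycleMap Y X Nm hcomp 0) (cocycleMap X Y Nm hcomp 0)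
    (LinearMap.ext fun f => Subtype.ext
      (pullCompare_pullCompare_zero Y X Nm hid hcomp f.1 f.2))
    (LinearMap.ext fun f => Subtype.ext
      (pullCompare_pullCompare_zero X Y Nm hid hcomp f.1 f.2))

/-- Cone complexes over the same preorder have isomorphic cohomology in positive degrees. -/
noncomputable def cohomologyEquiv (s : ℕ) : X.Cohomology Nm s ≃ₗ[ℤ] Y.Cohomology Nm s :=
  LinearEquiv.ofLinearMap (cohomologyMap Y X Nm hcomp s) (cohomologyMap X Y Nm hcomp s)
    (cohomologyMap_comp Y X Nm hid hcomp s) (cohomologyMap_comp X Y Nm hid hcomp s)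

end ConeComplex

end ConeComplex

section FaceComplexes

open Finsupp

variable {V : Type} {K : Set (Finset V)}

instance : PartialOrder (Face K) :=
  PartialOrder.lift (fun σ : Face K => σ.1) Subtype.val_injective

namespace FlagSimplex

/-- The label of a chain of faces is its largest face. -/
def top (s : ℕ) (c : FlagSimplex K s) : Face K := c.1 0

/-- The chain of faces with the `i`-th one deleted. -/
def face {s : ℕ} (c : FlagSimplex K (s + 1)) (i : Fin (s + 2)) : FlagSimplex K s :=
  ⟨fun j => c.1 (Fin.succAbove i j), c.2.comp_strictMono (Fin.strictMono_succAbove i)⟩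

theorem top_face_le {s : ℕ} (c : FlagSimplex K (s + 1)) (i : Fin (s + 2)) :
    (c.face i).top ≤ c.top :=
  c.2.antitone (Fin.zero_le _)

/-- The chain of faces with a larger face prepended. -/
def cons {s : ℕ} (p : Face K) (c : FlagSimplex K s) (h : c.top < p) : FlagSimplex K (s + 1) :=
  ⟨Fin.cons p c.1, by
    rw [Fin.strictAnti_iff_succ_lt]
    intro i
    cases i using Fin.cases with
    | zero => exact h
    | succ i => exact c.2 i.castSucc_lt_succ⟩

theorem face_cons_zero {s : ℕ} (p : Face K) (c : FlagSimplex K s) (h : c.top < p) :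
    (c.cons p h).face 0 = c := rfl

theorem face_cons_succ {s : ℕ} (p : Face K) (c : FlagSimplex K (s + 1)) (h : c.top < p)
    (i : Fin (s + 2)) :
    (c.cons p h).face i.succ = (c.face i).cons p ((c.top_face_le i).trans_lt h) := by
  refine Subtype.ext (funext fun j => ?_)
  cases j using Fin.cases with
  | zero => rfl
  | succ j => simp [face, cons]

theorem face_zero_top_lt {s : ℕ} (c : FlagSimplex K (s + 1)) : (c.face 0).top < c.top :=
  c.2 (Fin.succ_pos 0)

theorem cons_face_zero {s : ℕ} (c : FlagSimplex K (s + 1)) :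
    (c.face 0).cons c.top c.face_zero_top_lt = c := by
  refine Subtype.ext (funext fun j => ?_)
  cases j using Fin.cases with
  | zero => rfl
  | succ j => rfl

/-- The boundary of chains on the order complex. -/
noncomputable def boundary (s : ℕ) :
    (FlagSimplex K (s + 1) →₀ ℤ) →ₗ[ℤ] (FlagSimplex K s →₀ ℤ) :=
  Finsupp.linearCombination ℤ fun c =>
    ∑ i : Fin (s + 2), (-1 : ℤ) ^ (i : ℕ) • single (c.face i) 1

theorem boundary_single {s : ℕ} (c : FlagSimplex K (s + 1)) :
    boundary s (single c 1) = ∑ i : Fin (s + 2), (-1 : ℤ) ^ (i : ℕ) • single (c.face i) 1 := by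
  simp [boundary]

open Classical in
/-- Coning off a chain of faces by prepending `p`. -/
noncomputable def cone (s : ℕ) (p : Face K) :
    (FlagSimplex K s →₀ ℤ) →ₗ[ℤ] (FlagSimplex K (s + 1) →₀ ℤ) :=
  Finsupp.linearCombination ℤ fun c => if h : c.top < p then single (c.cons p h) 1 else 0

theorem cone_single_of_lt {s : ℕ} {p : Face K} {c : FlagSimplex K s} (h : c.top < p) :
    cone s p (single c 1) = single (c.cons p h) 1 := by
  simp [cone, h]

theorem cone_single_of_not_lt {s : ℕ} {p : Face K} {c : FlagSimplex K s} (h : ¬ c.top < p) :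
    cone s p (single c 1) = 0 := by
  simp [cone, h]

end FlagSimplex

open FlagSimplex in
/-- The order complex of `K` as a cone complex. -/
noncomputable def flagConeComplex (K : Set (Finset V)) : ConeComplex (Face K) where
  Simplex := FlagSimplex K
  top := FlagSimplex.top
  d := boundary
  apex p := ⟨fun _ => p, fun i j h => absurd h (by
    simp [Fin.fin_one_eq_zero i, Fin.fin_one_eq_zero j])⟩
  cone := FlagSimplex.cone
  carried_d s := carried_of_single fun c => by
    rw [boundary_single]
    exact sum_mem fun i _ =>
      Submodule.smul_mem _ _ (single_mem_below (c.top_face_le i) 1)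
  apex_le p := le_rfl
  cone_single_mem s p c hc := by
    by_cases h : c.top < p
    · rw [cone_single_of_lt h]
      exact single_mem_below le_rfl 1
    · rw [cone_single_of_not_lt h]
      exact zero_mem _
  d_cone_single_zero p c hc := by
    by_cases h : c.top < p
    · rw [cone_single_of_lt h, boundary_single, Fin.sum_univ_succ, Fin.sum_univ_one]
      simp only [Fin.val_zero, pow_zero, one_smul, face_cons_zero, Fin.val_succ, zero_add, pow_one,
        neg_smul, sub_eq_add_neg]
      congr 3
      exact Subtype.ext (funext fun j => by rw [Fin.fin_one_eq_zero j]; rfl)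
    · rw [cone_single_of_not_lt h, map_zero, eq_comm, sub_eq_zero]
      congr 1
      refine Subtype.ext (funext fun j => ?_)
      rw [Fin.fin_one_eq_zero j]
      exact eq_of_le_of_not_lt hc h
  d_cone_single_succ s p c hc := by
    by_cases h : c.top < p
    · rw [cone_single_of_lt h, boundary_single, Fin.sum_univ_succ, boundary_single, map_sum,
        sub_eq_add_neg, ← Finset.sum_neg_distrib, face_cons_zero]
      congr 1
      · simp
      · refine Finset.sum_congr rfl fun i _ => ?_
        rw [face_cons_succ, map_smul, cone_single_of_lt ((c.top_face_le i).trans_lt h),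
          Fin.val_succ, pow_succ, mul_neg_one, neg_smul]
    · obtain rfl : c.top = p := eq_of_le_of_not_lt hc h
      rw [cone_single_of_not_lt h, map_zero, boundary_single, map_sum, Fin.sum_univ_succ,
        Finset.sum_eq_zero, add_zero, map_smul, cone_single_of_lt c.face_zero_top_lt,
        cons_face_zero]
      · simp
      · intro i _
        rw [map_smul, cone_single_of_not_lt, smul_zero]
        exact lt_irrefl _
  exists_eq_cone s c := ⟨c.face 0, c.top_face_le 0, by
    rw [cone_single_of_lt c.face_zero_top_lt, cons_face_zero]⟩

theorem flagCoboundary_apply (Nobj : Face K → Type) [∀ σ, AddCommGroup (Nobj σ)]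
    (Nmap : ∀ {τ σ : Face K}, τ.1 ⊆ σ.1 → (Nobj τ →+ Nobj σ)) (s : ℕ)
    (f : FlagCochain K Nobj s) (c : FlagSimplex K (s + 1)) :
    flagCoboundary K Nobj @Nmap s f c = ∑ i : Fin (s + 2),
      (-1 : ℤ) ^ (i : ℕ) • Nmap (c.top_face_le i) (f (c.face i)) := by
  rw [flagCoboundary, LinearMap.pi_apply, LinearMap.sum_apply]
  rfl

theorem coboundary_flagConeComplex (Nobj : Face K → Type) [∀ σ, AddCommGroup (Nobj σ)]
    (Nmap : ∀ {τ σ : Face K}, τ.1 ⊆ σ.1 → (Nobj τ →+ Nobj σ)) (s : ℕ) :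
    (flagConeComplex K).coboundary (N := Nobj) @Nmap s = flagCoboundary K Nobj @Nmap s := by
  refine LinearMap.ext fun (f : ∀ c : FlagSimplex K s, Nobj c.top) =>
    funext fun (c : FlagSimplex K (s + 1)) => Eq.trans ?_ (flagCoboundary_apply ..).symm
  change evaluate (N := Nobj) @Nmap (FlagSimplex.top s) c.top
    (FlagSimplex.boundary s (single c 1)) f = _
  rw [FlagSimplex.boundary_single, map_sum, LinearMap.sum_apply]
  refine Finset.sum_congr rfl fun i _ => ?_
  rw [map_smul, LinearMap.smul_apply, evaluate_single (N := Nobj) @Nmap (c.top_face_le i)]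

/-- The simplices of `K` of dimension `s`. -/
abbrev FaceSimplex (K : Set (Finset V)) (s : ℕ) : Type := {σ : Face K // σ.1.card = s + 1}

namespace FaceSimplex

theorem ext {s : ℕ} {σ τ : FaceSimplex K s} (h : σ.1.1 = τ.1.1) : σ = τ :=
  Subtype.ext (Subtype.ext h)

theorem coe_eq_singleton (σ : FaceSimplex K 0) {v : V} (hv : v ∈ σ.1.1) : σ.1.1 = {v} := by
  obtain ⟨w, hw⟩ := Finset.card_eq_one.mp σ.2
  rw [hw, Finset.mem_singleton] at hv
  rw [hw, hv]

end FaceSimplex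

variable [LinearOrder V]

namespace FaceSimplex

/-- The `i`-th vertex of a simplex. -/
def vertex {s : ℕ} (σ : FaceSimplex K s) (i : Fin (s + 1)) : V :=
  σ.1.1.orderEmbOfFin σ.2 i

theorem vertex_mem {s : ℕ} (σ : FaceSimplex K s) (i : Fin (s + 1)) : σ.vertex i ∈ σ.1.1 :=
  Finset.orderEmbOfFin_mem _ _ _

theorem vertex_zero_le {s : ℕ} (σ : FaceSimplex K s) {v : V} (hv : v ∈ σ.1.1) :
    σ.vertex 0 ≤ v := by
  obtain ⟨i, rfl⟩ : v ∈ Set.range (σ.1.1.orderEmbOfFin σ.2) := by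
    rwa [Finset.range_orderEmbOfFin]
  exact (σ.1.1.orderEmbOfFin σ.2).monotone (Fin.zero_le i)

theorem vertex_injective {s : ℕ} (σ : FaceSimplex K s) : Function.Injective σ.vertex :=
  (σ.1.1.orderEmbOfFin σ.2).injective

variable (hdown : ∀ σ ∈ K, ∀ τ, τ ⊆ σ → τ.Nonempty → τ ∈ K)

/-- The face of a simplex opposite to its `i`-th vertex. -/
def face {s : ℕ} (σ : FaceSimplex K (s + 1)) (i : Fin (s + 2)) : FaceSimplex K s :=
  have hcard : (σ.1.1.erase (σ.vertex i)).card = s + 1 := by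
    rw [Finset.card_erase_of_mem (σ.vertex_mem i), σ.2]
    omega
  ⟨⟨σ.1.1.erase (σ.vertex i), hdown _ σ.1.2 _ (Finset.erase_subset _ _)
    (Finset.card_pos.mp (by rw [hcard]; exact s.succ_pos))⟩, hcard⟩

theorem coe_face {s : ℕ} (σ : FaceSimplex K (s + 1)) (i : Fin (s + 2)) :
    (face hdown σ i).1.1 = σ.1.1.erase (σ.vertex i) := rfl

theorem face_le {s : ℕ} (σ : FaceSimplex K (s + 1)) (i : Fin (s + 2)) :
    (face hdown σ i).1 ≤ σ.1 :=
  Finset.erase_subset _ _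

/-- The simplex spanned by `v` and the vertices of `τ`, inside a simplex `p` of `K`. -/
def insert {s : ℕ} (p : Face K) (v : V) (τ : FaceSimplex K s)
    (h : v ∈ p.1 ∧ v ∉ τ.1.1 ∧ τ.1 ≤ p) : FaceSimplex K (s + 1) :=
  ⟨⟨Insert.insert v τ.1.1, hdown _ p.2 _ (Finset.insert_subset h.1 h.2.2)
    (Finset.insert_nonempty _ _)⟩, by rw [Finset.card_insert_of_notMem h.2.1, τ.2]⟩

theorem coe_insert {s : ℕ} {p : Face K} {v : V} {τ : FaceSimplex K s}
    (h : v ∈ p.1 ∧ v ∉ τ.1.1 ∧ τ.1 ≤ p) :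
    (insert hdown p v τ h).1.1 = Insert.insert v τ.1.1 := rfl

theorem vertex_insert {s : ℕ} {p : Face K} {v : V} {τ : FaceSimplex K s}
    (h : v ∈ p.1 ∧ v ∉ τ.1.1 ∧ τ.1 ≤ p) (hv : ∀ w ∈ p.1, v ≤ w) :
    (insert hdown p v τ h).vertex = Fin.cons v τ.vertex := by
  refine (Finset.orderEmbOfFin_unique (insert hdown p v τ h).2 (fun i => ?_) ?_).symm
  · cases i using Fin.cases with
    | zero => exact Finset.mem_insert_self _ _
    | succ i => exact Finset.mem_insert_of_mem (τ.vertex_mem i)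
  · rw [Fin.strictMono_iff_lt_succ]
    intro i
    cases i using Fin.cases with
    | zero =>
      refine lt_of_le_of_ne (hv _ (h.2.2 (τ.vertex_mem 0))) ?_
      change v ≠ τ.vertex 0
      exact fun he => h.2.1 (he ▸ τ.vertex_mem 0)
    | succ i => exact (τ.1.1.orderEmbOfFin τ.2).strictMono i.castSucc_lt_succ

theorem face_insert_zero {s : ℕ} {p : Face K} {v : V} {τ : FaceSimplex K s}
    (h : v ∈ p.1 ∧ v ∉ τ.1.1 ∧ τ.1 ≤ p) (hv : ∀ w ∈ p.1, v ≤ w) :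
    face hdown (insert hdown p v τ h) 0 = τ := by
  refine ext ?_
  rw [coe_face, vertex_insert hdown h hv, coe_insert, Fin.cons_zero, Finset.erase_insert h.2.1]

theorem insert_condition_face {s : ℕ} {p : Face K} {v : V} {τ : FaceSimplex K (s + 1)}
    (h : v ∈ p.1 ∧ v ∉ τ.1.1 ∧ τ.1 ≤ p) (i : Fin (s + 2)) :
    v ∈ p.1 ∧ v ∉ (face hdown τ i).1.1 ∧ (face hdown τ i).1 ≤ p :=
  ⟨h.1, fun hv => h.2.1 (face_le hdown τ i hv), (face_le hdown τ i).trans h.2.2⟩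

theorem face_insert_succ {s : ℕ} {p : Face K} {v : V} {τ : FaceSimplex K (s + 1)}
    (h : v ∈ p.1 ∧ v ∉ τ.1.1 ∧ τ.1 ≤ p) (hv : ∀ w ∈ p.1, v ≤ w) (i : Fin (s + 2)) :
    face hdown (insert hdown p v τ h) i.succ =
      insert hdown p v (face hdown τ i) (insert_condition_face hdown h i) := by
  refine ext ?_
  rw [coe_face, vertex_insert hdown h hv, coe_insert, coe_insert, Fin.cons_succ, coe_face,
    Finset.erase_insert_of_ne]
  rintro rfl
  exact h.2.1 (τ.vertex_mem i)

theorem vertex_zero_insert_condition {s : ℕ} {p : Face K} (σ : FaceSimplex K (s + 1))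
    (hσ : σ.1 ≤ p) : σ.vertex 0 ∈ p.1 ∧ σ.vertex 0 ∉ (face hdown σ 0).1.1 ∧
      (face hdown σ 0).1 ≤ p :=
  ⟨hσ (σ.vertex_mem 0), Finset.notMem_erase _ _, (face_le hdown σ 0).trans hσ⟩

theorem insert_face_zero {s : ℕ} {p : Face K} (σ : FaceSimplex K (s + 1)) (hσ : σ.1 ≤ p) :
    insert hdown p (σ.vertex 0) (face hdown σ 0)
      (vertex_zero_insert_condition hdown σ hσ) = σ :=
  ext (Finset.insert_erase (σ.vertex_mem 0))

/-- The boundary of simplicial chains on `K`. -/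
noncomputable def boundary (s : ℕ) :
    (FaceSimplex K (s + 1) →₀ ℤ) →ₗ[ℤ] (FaceSimplex K s →₀ ℤ) :=
  Finsupp.linearCombination ℤ fun σ =>
    ∑ i : Fin (s + 2), (-1 : ℤ) ^ (i : ℕ) • single (face hdown σ i) 1

theorem boundary_single {s : ℕ} (σ : FaceSimplex K (s + 1)) :
    boundary hdown s (single σ 1) =
      ∑ i : Fin (s + 2), (-1 : ℤ) ^ (i : ℕ) • single (face hdown σ i) 1 := by
  simp [boundary]

open Classical in
/-- Coning off simplices of `p` with apex `v`. -/
noncomputable def cone (s : ℕ) (p : Face K) (v : V) :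
    (FaceSimplex K s →₀ ℤ) →ₗ[ℤ] (FaceSimplex K (s + 1) →₀ ℤ) :=
  Finsupp.linearCombination ℤ fun τ =>
    if h : v ∈ p.1 ∧ v ∉ τ.1.1 ∧ τ.1 ≤ p then single (insert hdown p v τ h) 1 else 0

theorem cone_single {s : ℕ} {p : Face K} {v : V} {τ : FaceSimplex K s}
    (h : v ∈ p.1 ∧ v ∉ τ.1.1 ∧ τ.1 ≤ p) :
    cone hdown s p v (single τ 1) = single (insert hdown p v τ h) 1 := by
  simp only [cone, linearCombination_single, one_smul, dif_pos h]

theorem cone_single_of_mem {s : ℕ} {p : Face K} {v : V} {τ : FaceSimplex K s}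
    (h : v ∈ τ.1.1) : cone hdown s p v (single τ 1) = 0 := by
  simp [cone, h]

theorem vertex_zero_eq {s : ℕ} {p : Face K} {v : V} {τ : FaceSimplex K s} (hτ : τ.1 ≤ p)
    (h : v ∈ τ.1.1) (hv : ∀ w ∈ p.1, v ≤ w) : τ.vertex 0 = v :=
  le_antisymm (τ.vertex_zero_le h) (hv _ (hτ (τ.vertex_mem 0)))

/-- The vertex `v` of `p`, as a zero-dimensional simplex. -/
def point (p : Face K) {v : V} (hv : v ∈ p.1) : FaceSimplex K 0 :=
  ⟨⟨{v}, hdown _ p.2 _ (Finset.singleton_subset_iff.mpr hv) (Finset.singleton_nonempty v)⟩,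
    Finset.card_singleton v⟩

theorem boundary_cone_single_zero {p : Face K} {v : V} (hvp : v ∈ p.1) (hv : ∀ w ∈ p.1, v ≤ w)
    {τ : FaceSimplex K 0} (hτ : τ.1 ≤ p) :
    boundary hdown 0 (cone hdown 0 p v (single τ 1)) =
      single τ 1 - single (point hdown p hvp) 1 := by
  by_cases h : v ∈ τ.1.1
  · rw [cone_single_of_mem hdown h, map_zero, eq_comm, sub_eq_zero]
    congr 1
    exact ext (coe_eq_singleton τ h)
  · have h' : v ∈ p.1 ∧ v ∉ τ.1.1 ∧ τ.1 ≤ p := ⟨hvp, h, hτ⟩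
    rw [cone_single hdown h', boundary_single, Fin.sum_univ_succ, Fin.sum_univ_one,
      face_insert_zero hdown h' hv]
    simp only [Fin.val_zero, pow_zero, one_smul, Fin.val_succ, zero_add, pow_one, neg_smul,
      sub_eq_add_neg]
    congr 3
    refine ext (coe_eq_singleton _ ?_)
    rw [coe_face, vertex_insert hdown h' hv, coe_insert, Fin.cons_succ, Finset.mem_erase]
    refine ⟨?_, Finset.mem_insert_self _ _⟩
    rintro rfl
    exact h (τ.vertex_mem 0)

theorem boundary_cone_single_succ {s : ℕ} {p : Face K} {v : V} (hvp : v ∈ p.1)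
    (hv : ∀ w ∈ p.1, v ≤ w) {τ : FaceSimplex K (s + 1)} (hτ : τ.1 ≤ p) :
    boundary hdown (s + 1) (cone hdown (s + 1) p v (single τ 1)) =
      single τ 1 - cone hdown s p v (boundary hdown s (single τ 1)) := by
  by_cases h : v ∈ τ.1.1
  · obtain rfl := vertex_zero_eq hτ h hv
    rw [cone_single_of_mem hdown h, map_zero, boundary_single, map_sum, Fin.sum_univ_succ,
      Finset.sum_eq_zero, add_zero, map_smul,
      cone_single hdown (vertex_zero_insert_condition hdown τ hτ), insert_face_zero hdown τ hτ]
    · simp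
    · intro i _
      rw [map_smul, cone_single_of_mem, smul_zero]
      rw [coe_face, Finset.mem_erase]
      exact ⟨fun he => (Fin.succ_ne_zero i) (τ.vertex_injective he).symm, h⟩
  · have h' : v ∈ p.1 ∧ v ∉ τ.1.1 ∧ τ.1 ≤ p := ⟨hvp, h, hτ⟩
    rw [cone_single hdown h', boundary_single, Fin.sum_univ_succ, boundary_single, map_sum,
      sub_eq_add_neg, ← Finset.sum_neg_distrib, face_insert_zero hdown h' hv]
    congr 1
    · simp
    · refine Finset.sum_congr rfl fun i _ => ?_
      rw [face_insert_succ hdown h' hv, map_smul,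
        cone_single hdown (insert_condition_face hdown h' i), Fin.val_succ, pow_succ,
        mul_neg_one, neg_smul]

end FaceSimplex

open FaceSimplex in
/-- The simplicial complex `K` as a cone complex. -/
noncomputable def faceConeComplex (hne : ∀ σ ∈ K, σ.Nonempty)
    (hdown : ∀ σ ∈ K, ∀ τ, τ ⊆ σ → τ.Nonempty → τ ∈ K) : ConeComplex (Face K) where
  Simplex := FaceSimplex K
  top _ σ := σ.1
  d := boundary hdown
  apex p := point hdown p (p.1.min'_mem (hne _ p.2))
  cone s p := FaceSimplex.cone hdown s p (p.1.min' (hne _ p.2))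
  carried_d s := carried_of_single fun σ => by
    rw [boundary_single]
    exact sum_mem fun i _ => Submodule.smul_mem _ _ (single_mem_below (face_le hdown σ i) 1)
  apex_le p := Finset.singleton_subset_iff.mpr (p.1.min'_mem (hne _ p.2))
  cone_single_mem s p τ hτ := by
    by_cases h : p.1.min' (hne _ p.2) ∈ τ.1.1
    · rw [cone_single_of_mem hdown h]
      exact zero_mem _
    · rw [cone_single hdown ⟨p.1.min'_mem _, h, hτ⟩]
      exact Finsupp.single_mem_supported ℤ _ (Finset.insert_subset (p.1.min'_mem _) hτ)
  d_cone_single_zero p τ hτ :=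
    boundary_cone_single_zero hdown (p.1.min'_mem _) (fun w hw => p.1.min'_le w hw) hτ
  d_cone_single_succ s p τ hτ :=
    boundary_cone_single_succ hdown (p.1.min'_mem _) (fun w hw => p.1.min'_le w hw) hτ
  exists_eq_cone s σ := ⟨face hdown σ 0, face_le hdown σ 0, by
    rw [← vertex_zero_eq (le_refl σ.1) (σ.1.1.min'_mem (hne _ σ.1.2))
        fun w hw => σ.1.1.min'_le w hw,
      cone_single hdown (vertex_zero_insert_condition hdown σ (le_refl σ.1)),
      insert_face_zero hdown σ (le_refl σ.1)]⟩

theorem simpCoboundary_apply (hdown : ∀ σ ∈ K, ∀ τ, τ ⊆ σ → τ.Nonempty → τ ∈ K)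
    (Nobj : Face K → Type) [∀ σ, AddCommGroup (Nobj σ)]
    (Nmap : ∀ {τ σ : Face K}, τ.1 ⊆ σ.1 → (Nobj τ →+ Nobj σ)) (s : ℕ)
    (f : SimpCochain K Nobj s) (σ : FaceSimplex K (s + 1)) :
    simpCoboundary K Nobj @Nmap hdown s f σ = ∑ i : Fin (s + 2),
      (-1 : ℤ) ^ (i : ℕ) •
        Nmap (FaceSimplex.face_le hdown σ i) (f (FaceSimplex.face hdown σ i)) := by
  rw [simpCoboundary, LinearMap.pi_apply, LinearMap.sum_apply]
  rfl

theorem coboundary_faceConeComplex (hne : ∀ σ ∈ K, σ.Nonempty)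
    (hdown : ∀ σ ∈ K, ∀ τ, τ ⊆ σ → τ.Nonempty → τ ∈ K)
    (Nobj : Face K → Type) [∀ σ, AddCommGroup (Nobj σ)]
    (Nmap : ∀ {τ σ : Face K}, τ.1 ⊆ σ.1 → (Nobj τ →+ Nobj σ)) (s : ℕ) :
    (faceConeComplex hne hdown).coboundary (N := Nobj) @Nmap s =
      simpCoboundary K Nobj @Nmap hdown s := by
  refine LinearMap.ext fun (f : SimpCochain K Nobj s) =>
    funext fun (σ : FaceSimplex K (s + 1)) => Eq.trans ?_ (simpCoboundary_apply ..).symm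
  change evaluate (N := Nobj) @Nmap (fun σ : FaceSimplex K s => σ.1) σ.1
    (FaceSimplex.boundary hdown s (single σ 1)) f = _
  rw [FaceSimplex.boundary_single, map_sum, LinearMap.sum_apply]
  refine Finset.sum_congr rfl fun i _ => ?_
  rw [map_smul, LinearMap.smul_apply,
    evaluate_single (N := Nobj) @Nmap (FaceSimplex.face_le hdown σ i)]

end FaceComplexes

/-- for a finite simplicial complex `K` and a dual coefficient system
`N` on the face poset of `K`, the simplicial cohomology of `K` with coefficients in
`N` is isomorphic to the simplicial cohomology of the order (flag) complex `K'` with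
coefficients in the induced dual system `N_*(σ₀ ⊋ ⋯ ⊋ σₛ) = N(σ₀)`. -/
theorem subdivision_cohomology_iso
    {V : Type} [LinearOrder V] (K : Set (Finset V))
    (hfin : K.Finite)
    (hne : ∀ σ ∈ K, σ.Nonempty)
    (hdown : ∀ σ ∈ K, ∀ τ, τ ⊆ σ → τ.Nonempty → τ ∈ K)
    (Nobj : Face K → Type) [∀ σ, AddCommGroup (Nobj σ)]
    (Nmap : ∀ {τ σ : Face K}, τ.1 ⊆ σ.1 → (Nobj τ →+ Nobj σ))
    (hid : ∀ σ : Face K, Nmap (subset_refl σ.1) = AddMonoidHom.id (Nobj σ))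
    (hcomp : ∀ (τ σ ρ : Face K) (h1 : τ.1 ⊆ σ.1) (h2 : σ.1 ⊆ ρ.1),
      (Nmap h2).comp (Nmap h1) = Nmap (h1.trans h2)) :
    Nonempty
      (LinearMap.ker (simpCoboundary K Nobj @Nmap hdown 0) ≃ₗ[ℤ]
        LinearMap.ker (flagCoboundary K Nobj @Nmap 0)) ∧
    ∀ s : ℕ,
      Nonempty
        ((LinearMap.ker (simpCoboundary K Nobj @Nmap hdown (s + 1)) ⧸
            Submodule.comap (LinearMap.ker (simpCoboundary K Nobj @Nmap hdown (s + 1))).subtype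
              (LinearMap.range (simpCoboundary K Nobj @Nmap hdown s))) ≃ₗ[ℤ]
          (LinearMap.ker (flagCoboundary K Nobj @Nmap (s + 1)) ⧸
            Submodule.comap (LinearMap.ker (flagCoboundary K Nobj @Nmap (s + 1))).subtype
              (LinearMap.range (flagCoboundary K Nobj @Nmap s)))) := by
  have hface := coboundary_faceConeComplex hne hdown Nobj @Nmap
  have hflag := coboundary_flagConeComplex (K := K) Nobj @Nmap
  refine ⟨?_, fun s => ?_⟩
  · rw [← hface, ← hflag]
    exact ⟨ConeComplex.cocycleEquiv (faceConeComplex hne hdown) (flagConeComplex K)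
      (N := Nobj) @Nmap hid hcomp⟩
  · rw [← hface, ← hface, ← hflag, ← hflag]
    exact ⟨ConeComplex.cohomologyEquiv (faceConeComplex hne hdown) (flagConeComplex K)
      (N := Nobj) @Nmap hid hcomp s⟩
end
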